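/- arXiv:2401.15837 — 4 statements merged into one kernel-verified Lean document; each statement's English description precedes it below -/
import Mathlib

section
/- Suppose K is closed at infinity, d = deg f ≥ 1, and there exists x* ∈ K with f(x*) = f_min (a global minimizer). Then for every ε > 0 one has f_min < f^(ε) ≤ f_min + ε · p · (1 + ‖x*‖²)^{d/2}. -/
open MvPolynomial

/-- A homogeneous polynomial of degree `d` evaluates homogeneously of degree `d`. -/
theorem MvPolynomial.IsHomogeneous.eval_smul_point {σ R : Type*} [Fintype σ] [CommRing R]
    {F : MvPolynomial σ R} {d : ℕ} (hF : F.IsHomogeneous d) (c : R) (y : σ → R) :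
    eval (c • y) F = c ^ d * eval y F := by
  rw [eval_eq', eval_eq', Finset.mul_sum]
  refine Finset.sum_congr rfl fun s hs => ?_
  have h : ∑ i, s i = d := by
    have := hF (mem_support_iff.mp hs)
    rw [Finsupp.weight_apply, Finsupp.sum_fintype _ _ (by simp)] at this
    simpa using this
  simp only [Pi.smul_apply, smul_eq_mul, mul_pow, Finset.prod_mul_distrib,
    Finset.prod_pow_eq_pow_sum, h]
  ring

/-- Even power sums are bounded below on sets where the sum of squares is bounded below. -/
theorem half_pow_div_card_pow_le_sum_pow {ι κ : Type*} [Fintype ι] [Fintype κ] (k : ℕ)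
    (y : ι → ℝ) (w : κ → ℝ) (hι : 1 ≤ Fintype.card ι) (l : κ)
    (h : 1 ≤ ∑ i, y i ^ 2 + w l ^ 2) :
    (1 / 2) ^ (k + 1) / (Fintype.card ι : ℝ) ^ k ≤
      ∑ i, y i ^ (2 * (k + 1)) + ∑ j, w j ^ (2 * (k + 1)) := by
  have hy : 0 ≤ ∑ i, y i ^ (2 * (k + 1)) :=
    Finset.sum_nonneg fun i _ => (even_two_mul _).pow_nonneg _
  have hw : 0 ≤ ∑ j, w j ^ (2 * (k + 1)) :=
    Finset.sum_nonneg fun i _ => (even_two_mul _).pow_nonneg _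
  have hcard : (1 : ℝ) ≤ (Fintype.card ι : ℝ) := by exact_mod_cast hι
  rcases le_or_gt (1 / 2) (w l ^ 2) with hl | hl
  · have h1 : (1 / 2 : ℝ) ^ (k + 1) ≤ w l ^ (2 * (k + 1)) := by
      rw [pow_mul]
      gcongr
    have h2 : w l ^ (2 * (k + 1)) ≤ ∑ j, w j ^ (2 * (k + 1)) :=
      Finset.single_le_sum (f := fun j => w j ^ (2 * (k + 1)))
        (fun i _ => (even_two_mul _).pow_nonneg _) (Finset.mem_univ l)
    have h3 : (1 / 2 : ℝ) ^ (k + 1) / (Fintype.card ι : ℝ) ^ k ≤ (1 / 2) ^ (k + 1) :=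
      div_le_self (by positivity) (one_le_pow₀ hcard)
    linarith
  · have h1 := pow_sum_div_card_le_sum_pow (s := Finset.univ) (f := fun i => y i ^ 2)
      (fun i _ => sq_nonneg _) k
    have h2 : (1 / 2 : ℝ) ^ (k + 1) / (Fintype.card ι : ℝ) ^ k ≤
        (∑ i, y i ^ 2) ^ (k + 1) / (Fintype.card ι : ℝ) ^ k := by
      gcongr
      linarith
    simp only [← pow_mul, Finset.card_univ] at h1
    linarith

/-- If `b` is a lower bound of `f` on a set closed at infinity, then `F - b * y₀ ^ d`, where `F`
is the homogenization of `f`, is nonnegative on the whole homogenized cone. -/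
theorem mul_pow_le_eval_of_homogenized {n m : ℕ} {f : MvPolynomial (Fin n) ℝ}
    {g : Fin m → MvPolynomial (Fin n) ℝ} {d : ℕ} (hd1 : 1 ≤ d) {F : MvPolynomial (Fin (n + 1)) ℝ}
    (hFhom : F.IsHomogeneous d) (hFdeh : ∀ x : Fin n → ℝ, eval (Fin.cons 1 x) F = eval x f)
    {G : Fin m → MvPolynomial (Fin (n + 1)) ℝ} {e : Fin m → ℕ}
    (hGhom : ∀ j, (G j).IsHomogeneous (e j))
    (hGdeh : ∀ j, ∀ x : Fin n → ℝ, eval (Fin.cons 1 x) (G j) = eval x (g j))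
    {Kt : Set (Fin (n + 1) → ℝ)}
    (hKt : Kt = {y | (∀ j, 0 ≤ eval y (G j)) ∧ 0 ≤ y 0 ∧ ∑ i, (y i) ^ 2 = 1})
    (hclosed : Kt = closure (Kt ∩ {y | 0 < y 0}))
    {b : ℝ} (hlow : ∀ x : Fin n → ℝ, (∀ j, 0 ≤ eval x (g j)) → b ≤ eval x f)
    {y : Fin (n + 1) → ℝ} (hyG : ∀ j, 0 ≤ eval y (G j)) (hy0 : 0 ≤ y 0) :
    b * y 0 ^ d ≤ eval y F := by
  have hpos : ∀ y : Fin (n + 1) → ℝ, (∀ j, 0 ≤ eval y (G j)) → 0 < y 0 →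
      b * y 0 ^ d ≤ eval y F := by
    intro y hyG hy0
    set x : Fin n → ℝ := fun i => (y 0)⁻¹ * y i.succ with hx
    have hxy : (y 0)⁻¹ • y = (Fin.cons 1 x : Fin (n + 1) → ℝ) := by
      ext i
      refine Fin.cases ?_ (fun i => ?_) i
      · simp [hy0.ne']
      · simp [hx]
    have hbx : b ≤ eval x f := by
      refine hlow x fun j => ?_
      rw [← hGdeh, ← hxy, (hGhom j).eval_smul_point]
      have := hyG j
      positivity
    rw [← hFdeh, ← hxy, hFhom.eval_smul_point, inv_pow, ← div_eq_inv_mul,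
      le_div_iff₀ (by positivity)] at hbx
    exact hbx
  have hKtF : Kt ⊆ {y | b * y 0 ^ d ≤ eval y F} := by
    rw [hclosed]
    refine closure_minimal ?_ (isClosed_le (by fun_prop) (continuous_eval F))
    rintro y ⟨hy, hy0⟩
    rw [hKt] at hy
    exact hpos y hy.1 hy0
  rcases eq_or_ne y 0 with rfl | hne
  · have h := hFhom.eval_smul_point 0 (0 : Fin (n + 1) → ℝ)
    rw [zero_pow (by omega), zero_mul, zero_smul] at h
    rw [h, Pi.zero_apply, zero_pow (by omega), mul_zero]
  · have hS : 0 < ∑ i, y i ^ 2 := by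
      obtain ⟨i, hi⟩ := Function.ne_iff.mp hne
      exact Finset.sum_pos' (fun i _ => sq_nonneg _)
        ⟨i, Finset.mem_univ i, sq_pos_of_ne_zero hi⟩
    set r := √(∑ i, y i ^ 2) with hr
    have hr0 : 0 < r := Real.sqrt_pos.mpr hS
    have hmem : r⁻¹ • y ∈ Kt := by
      rw [hKt]
      refine ⟨fun j => ?_, ?_, ?_⟩
      · rw [(hGhom j).eval_smul_point]
        have := hyG j
        positivity
      · simp only [Pi.smul_apply, smul_eq_mul]
        positivity
      · simp only [Pi.smul_apply, smul_eq_mul, mul_pow, ← Finset.mul_sum, inv_pow]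
        rw [hr, Real.sq_sqrt hS.le, inv_mul_cancel₀ hS.ne']
    have h := hKtF hmem
    simp only [Set.mem_ofPred_eq, Pi.smul_apply, smul_eq_mul, mul_pow,
      hFhom.eval_smul_point] at h
    have hrd : 0 < r⁻¹ ^ d := by positivity
    refine le_of_mul_le_mul_left ?_ hrd
    linarith

/-- Suppose `K` is closed at infinity, `d = deg f ≥ 1`, and there exists
`x* ∈ K` with `f(x*) = f_min` (a global minimizer). Then for every `ε > 0` one has
`f_min < f^(ε) ≤ f_min + ε · p · (1 + ‖x*‖²)^{d/2}`. -/
theorem stmt_0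
    (n m p : ℕ) (hn : 1 ≤ n) (hm : 1 ≤ m) (hp : 1 ≤ p)
    (f : MvPolynomial (Fin n) ℝ) (g : Fin m → MvPolynomial (Fin n) ℝ)
    (I : Fin p → Finset (Fin n)) (hI : ∀ i : Fin n, ∃ ℓ : Fin p, i ∈ I ℓ)
    (K : Set (Fin n → ℝ)) (hK : K = {x | ∀ j, 0 ≤ eval x (g j)})
    (d : ℕ) (hd : d = f.totalDegree) (hd1 : 1 ≤ d)
    (d0 : ℕ) (hd0 : d0 = 2 * ((d + 1) / 2))
    -- homogenizations
    (F : MvPolynomial (Fin (n + 1)) ℝ)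
    (hFhom : F.IsHomogeneous d)
    (hFdeh : ∀ x : Fin n → ℝ, eval (Fin.cons 1 x) F = eval x f)
    (G : Fin m → MvPolynomial (Fin (n + 1)) ℝ)
    (hGhom : ∀ j, (G j).IsHomogeneous (g j).totalDegree)
    (hGdeh : ∀ j, ∀ x : Fin n → ℝ, eval (Fin.cons 1 x) (G j) = eval x (g j))
    -- K is closed at infinity
    (Kt : Set (Fin (n + 1) → ℝ))
    (hKt : Kt = {y | (∀ j, 0 ≤ eval y (G j)) ∧ 0 ≤ y 0 ∧ ∑ i, (y i) ^ 2 = 1})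
    (hclosed : Kt = closure (Kt ∩ {y | 0 < y 0}))
    -- f_min, attained at a global minimizer x*
    (fmin : ℝ) (xstar : Fin n → ℝ) (hxK : xstar ∈ K)
    (hlow : ∀ x ∈ K, fmin ≤ eval x f) (hattain : eval xstar f = fmin)
    -- the sparse homogenized set K̃ₛ¹
    (Ks : Set ((Fin (n + 1) → ℝ) × (Fin p → ℝ)))
    (hKs : Ks = {z | 0 ≤ z.1 0 ∧ (∀ j, 0 ≤ eval z.1 (G j)) ∧
      ∀ ℓ : Fin p, ((z.1 0) ^ 2 + ∑ i ∈ I ℓ, (z.1 i.succ) ^ 2) + (z.2 ℓ) ^ 2 = 1})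
    (ε : ℝ) (hε : 0 < ε)
    (feps : ℝ)
    (hfeps : feps = sSup {γ : ℝ | ∀ z ∈ Ks,
      0 ≤ eval z.1 F + ε * ((∑ i, (z.1 i) ^ d0) + ∑ ℓ, (z.2 ℓ) ^ d0) - γ * (z.1 0) ^ d}) :
    fmin < feps ∧
      feps ≤ fmin + ε * p * (1 + ∑ i, (xstar i) ^ 2) ^ ((d : ℝ) / 2) := by
  obtain ⟨k, hk⟩ : ∃ k, d0 = 2 * (k + 1) := ⟨(d + 1) / 2 - 1, by omega⟩
  subst hk
  set A : ℝ := 1 + ∑ i, xstar i ^ 2 with hA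
  have hA0 : 0 < A := by
    have : 0 ≤ ∑ i, xstar i ^ 2 := Finset.sum_nonneg fun i _ => sq_nonneg _
    linarith
  set S : Set ℝ := {γ : ℝ | ∀ z ∈ Ks, 0 ≤ eval z.1 F +
    ε * ((∑ i, (z.1 i) ^ (2 * (k + 1))) + ∑ ℓ, (z.2 ℓ) ^ (2 * (k + 1))) - γ * (z.1 0) ^ d} with hS
  have hub : ∀ γ ∈ S, γ ≤ fmin + ε * p * A ^ ((d : ℝ) / 2) := by
    intro γ hγ
    set t : ℝ := (√A)⁻¹ with ht
    have ht0 : 0 < t := by positivity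
    have ht2 : t ^ 2 * A = 1 := by
      rw [ht, inv_pow, Real.sq_sqrt hA0.le, inv_mul_cancel₀ hA0.ne']
    have htd : (t ^ d) * A ^ ((d : ℝ) / 2) = 1 := by
      have : A ^ ((d : ℝ) / 2) = √A ^ d := by
        rw [Real.sqrt_eq_rpow, ← Real.rpow_natCast, ← Real.rpow_mul hA0.le]
        congr 1
        ring
      rw [this, ht, ← mul_pow, inv_mul_cancel₀ (by positivity), one_pow]
    set y : Fin (n + 1) → ℝ := t • (Fin.cons 1 xstar : Fin (n + 1) → ℝ) with hy
    have hy0 : y 0 = t := by simp [hy]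
    have hysum : ∑ i, y i ^ 2 = 1 := by
      rw [← ht2, hA, Fin.sum_univ_succ]
      simp [hy, mul_pow, ← Finset.mul_sum, mul_add]
    have hblock : ∀ ℓ, y 0 ^ 2 + ∑ i ∈ I ℓ, y i.succ ^ 2 ≤ 1 := by
      intro ℓ
      rw [← hysum, Fin.sum_univ_succ]
      exact add_le_add le_rfl (Finset.sum_le_univ_sum_of_nonneg fun i => sq_nonneg (y (Fin.succ i)))
    set w : Fin p → ℝ := fun ℓ => √(1 - (y 0 ^ 2 + ∑ i ∈ I ℓ, y i.succ ^ 2)) with hw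
    have hw2 : ∀ ℓ, w ℓ ^ 2 = 1 - (y 0 ^ 2 + ∑ i ∈ I ℓ, y i.succ ^ 2) := fun ℓ =>
      Real.sq_sqrt (by linarith [hblock ℓ])
    have hxK' := hxK
    rw [hK] at hxK'
    have hmem : (y, w) ∈ Ks := by
      rw [hKs]
      refine ⟨ht0.le.trans_eq hy0.symm, fun j => ?_, fun ℓ => ?_⟩
      · have := hxK' j
        simp only [hy]
        rw [(hGhom j).eval_smul_point, hGdeh]
        positivity
      · simp only [hw2]
        ring
    have hγz := hγ _ hmem
    have hyF : eval y F = t ^ d * fmin := by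
      rw [hy, hFhom.eval_smul_point, hFdeh, hattain]
    simp only [hyF, hy0] at hγz
    have hpow : ∀ a : ℝ, a ^ 2 ≤ 1 → a ^ (2 * (k + 1)) ≤ a ^ 2 := by
      intro a ha
      rw [pow_mul]
      exact pow_le_of_le_one (sq_nonneg a) ha (by omega)
    have hsy : ∑ i, y i ^ (2 * (k + 1)) ≤ ∑ i, y i ^ 2 := by
      refine Finset.sum_le_sum fun i _ => hpow _ ?_
      rw [← hysum]
      exact Finset.single_le_sum (f := fun i => y i ^ 2) (fun i _ => sq_nonneg _)
        (Finset.mem_univ i)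
    have hsw : ∑ ℓ, w ℓ ^ (2 * (k + 1)) ≤ ∑ ℓ, w ℓ ^ 2 := by
      refine Finset.sum_le_sum fun ℓ _ => hpow _ ?_
      rw [hw2]
      have : 0 ≤ ∑ i ∈ I ℓ, y i.succ ^ 2 := Finset.sum_nonneg fun i _ => sq_nonneg _
      nlinarith [sq_nonneg (y 0)]
    have hcover : (∑ i, y i ^ 2) + ∑ ℓ, w ℓ ^ 2 ≤ p := by
      have h0 : y 0 ^ 2 ≤ p * y 0 ^ 2 := by
        have : (1 : ℝ) ≤ p := by exact_mod_cast hp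
        nlinarith [sq_nonneg (y 0)]
      have h1 : ∑ i : Fin n, y i.succ ^ 2 ≤ ∑ ℓ, ∑ i ∈ I ℓ, y i.succ ^ 2 := by
        rw [Finset.sum_comm' (t' := Finset.univ) (s' := fun i => {ℓ | i ∈ I ℓ}) (by simp)]
        refine Finset.sum_le_sum fun i _ => ?_
        obtain ⟨ℓ, hℓ⟩ := hI i
        exact Finset.single_le_sum (f := fun _ : Fin p => y i.succ ^ 2) (fun _ _ => sq_nonneg _)
          (by simpa using hℓ)
      simp only [hw2, Finset.sum_sub_distrib, Finset.sum_add_distrib, Finset.sum_const,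
        Finset.card_univ, Fintype.card_fin, nsmul_eq_mul, mul_one]
      rw [Fin.sum_univ_succ]
      linarith
    have h2 : ε * ((∑ i, y i ^ (2 * (k + 1))) + ∑ ℓ, w ℓ ^ (2 * (k + 1))) ≤ ε * p := by
      gcongr
      linarith
    have h3 : t ^ d * γ ≤ t ^ d * (fmin + ε * p * A ^ ((d : ℝ) / 2)) := by
      have : t ^ d * (fmin + ε * p * A ^ ((d : ℝ) / 2)) =
          t ^ d * fmin + ε * p * (t ^ d * A ^ ((d : ℝ) / 2)) := by ring
      rw [this, htd]
      linarith
    exact le_of_mul_le_mul_left h3 (by positivity)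
  set c : ℝ := (1 / 2) ^ (k + 1) / (Fintype.card (Fin (n + 1)) : ℝ) ^ k with hc
  have hc0 : 0 < c := by
    rw [hc, Fintype.card_fin]
    positivity
  have hcS : fmin + ε * c ∈ S := by
    intro z hz
    rw [hKs] at hz
    obtain ⟨hz0, hzG, hzw⟩ := hz
    have h1 : fmin * z.1 0 ^ d ≤ eval z.1 F :=
      mul_pow_le_eval_of_homogenized hd1 hFhom hFdeh hGhom hGdeh hKt hclosed
        (fun x hx => hlow x (by rw [hK]; exact hx)) hzG hz0
    let l : Fin p := ⟨0, hp⟩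
    have hl := hzw l
    have hsub : ∑ i ∈ I l, z.1 i.succ ^ 2 ≤ ∑ i : Fin n, z.1 i.succ ^ 2 :=
      Finset.sum_le_univ_sum_of_nonneg fun i => sq_nonneg _
    have h2 := half_pow_div_card_pow_le_sum_pow k z.1 z.2 (by simp) l
      (by rw [Fin.sum_univ_succ]; linarith)
    have h3 : z.1 0 ^ d ≤ 1 := by
      have : 0 ≤ ∑ i ∈ I l, z.1 i.succ ^ 2 := Finset.sum_nonneg fun i _ => sq_nonneg _
      refine pow_le_one₀ hz0 ?_
      nlinarith [sq_nonneg (z.2 l)]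
    have h4 := mul_le_mul_of_nonneg_left h2 hε.le
    have h5 : ε * c * z.1 0 ^ d ≤ ε * c := mul_le_of_le_one_right (by positivity) h3
    linarith
  rw [hfeps]
  refine ⟨?_, csSup_le ⟨_, hcS⟩ hub⟩
  have hle : fmin + ε * c ≤ sSup S := le_csSup ⟨_, hub⟩ hcS
  have : 0 < ε * c := by positivity
  linarith
end

section
/- Suppose K is closed at infinity, d = deg f ≥ 1, and there exists x* ∈ K with f(x*) = f_min (a global minimizer). Then f^(0) = f_min, i.e., sup{γ ∈ ℝ : f̃(x̃) − γ x_0^d ≥ 0 for all (x̃,w) ∈ K̃_s¹} = f_min. -/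
open MvPolynomial

theorem MvPolynomial.IsHomogeneous.eval_mul_eq_pow_mul {σ R : Type*} [CommSemiring R]
    {P : MvPolynomial σ R} {k : ℕ} (hP : P.IsHomogeneous k) (c : R) (y : σ → R) :
    eval (fun i => c * y i) P = c ^ k * eval y P := by
  rw [eval_eq, eval_eq, Finset.mul_sum]
  refine Finset.sum_congr rfl fun s hs => ?_
  have hdeg : ∑ i ∈ s.support, s i = k := by
    rw [← hP (mem_support_iff.mp hs), Finsupp.weight_apply, Finsupp.sum]
    simp
  simp only [mul_pow, Finset.prod_mul_distrib, Finset.prod_pow_eq_pow_sum, hdeg]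
  ring

/-- Suppose `K` is closed at infinity, `d = deg f ≥ 1`, and there exists
`x* ∈ K` with `f(x*) = f_min`. Then `f^(0) = f_min`, i.e.
`sup {γ : f̃(x̃) − γ x₀^d ≥ 0 on K̃ₛ¹} = f_min`. -/
theorem stmt_1
    (n m p : ℕ) (hn : 1 ≤ n) (hm : 1 ≤ m) (hp : 1 ≤ p)
    (f : MvPolynomial (Fin n) ℝ) (g : Fin m → MvPolynomial (Fin n) ℝ)
    (I : Fin p → Finset (Fin n)) (hI : ∀ i : Fin n, ∃ ℓ : Fin p, i ∈ I ℓ)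
    (K : Set (Fin n → ℝ)) (hK : K = {x | ∀ j, 0 ≤ eval x (g j)})
    (d : ℕ) (hd : d = f.totalDegree) (hd1 : 1 ≤ d)
    -- homogenizations
    (F : MvPolynomial (Fin (n + 1)) ℝ)
    (hFhom : F.IsHomogeneous d)
    (hFdeh : ∀ x : Fin n → ℝ, eval (Fin.cons 1 x) F = eval x f)
    (G : Fin m → MvPolynomial (Fin (n + 1)) ℝ)
    (hGhom : ∀ j, (G j).IsHomogeneous (g j).totalDegree)
    (hGdeh : ∀ j, ∀ x : Fin n → ℝ, eval (Fin.cons 1 x) (G j) = eval x (g j))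
    -- K is closed at infinity
    (Kt : Set (Fin (n + 1) → ℝ))
    (hKt : Kt = {y | (∀ j, 0 ≤ eval y (G j)) ∧ 0 ≤ y 0 ∧ ∑ i, (y i) ^ 2 = 1})
    (hclosed : Kt = closure (Kt ∩ {y | 0 < y 0}))
    -- f_min, attained at a global minimizer x*
    (fmin : ℝ) (xstar : Fin n → ℝ) (hxK : xstar ∈ K)
    (hlow : ∀ x ∈ K, fmin ≤ eval x f) (hattain : eval xstar f = fmin)
    -- the sparse homogenized set K̃ₛ¹
    (Ks : Set ((Fin (n + 1) → ℝ) × (Fin p → ℝ)))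
    (hKs : Ks = {z | 0 ≤ z.1 0 ∧ (∀ j, 0 ≤ eval z.1 (G j)) ∧
      ∀ ℓ : Fin p, ((z.1 0) ^ 2 + ∑ i ∈ I ℓ, (z.1 i.succ) ^ 2) + (z.2 ℓ) ^ 2 = 1}) :
    sSup {γ : ℝ | ∀ z ∈ Ks, 0 ≤ eval z.1 F - γ * (z.1 0) ^ d} = fmin := by
  subst hK hKs
  have hpos : ∀ y : Fin (n + 1) → ℝ, 0 < y 0 → (∀ j, 0 ≤ eval y (G j)) →
      0 ≤ eval y F - fmin * y 0 ^ d := by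
    intro y hy0 hyG
    set x : Fin n → ℝ := fun i => y i.succ / y 0 with hx
    have hy : y = fun i => y 0 * (Fin.cons 1 x : Fin (n + 1) → ℝ) i := by
      funext i
      refine Fin.cases ?_ (fun i => ?_) i
      · simp
      · simp only [Fin.cons_succ, hx]
        field_simp
    have hxK' : ∀ j, 0 ≤ eval x (g j) := by
      intro j
      have h := hyG j
      rw [hy, (hGhom j).eval_mul_eq_pow_mul, hGdeh] at h
      exact nonneg_of_mul_nonneg_right h (pow_pos hy0 _)
    have hFy : eval y F = y 0 ^ d * eval x f := by
      conv_lhs => rw [hy]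
      rw [hFhom.eval_mul_eq_pow_mul, hFdeh]
    rw [hFy]
    nlinarith [mul_nonneg (pow_nonneg hy0.le d) (sub_nonneg.mpr (hlow x hxK'))]
  have hKt_nonneg : ∀ y ∈ Kt, 0 ≤ eval y F - fmin * y 0 ^ d := by
    have hcl : IsClosed {y : Fin (n + 1) → ℝ | 0 ≤ eval y F - fmin * y 0 ^ d} :=
      isClosed_le continuous_const
        ((MvPolynomial.continuous_eval F).sub
          (continuous_const.mul ((continuous_apply 0).pow d)))
    intro y hy
    rw [hclosed] at hy
    refine closure_minimal ?_ hcl hy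
    rintro u ⟨hu, hu0⟩
    rw [hKt] at hu
    exact hpos u hu0 hu.1
  refine IsGreatest.csSup_eq ⟨?_, ?_⟩
  · rintro ⟨y, w⟩ ⟨hy0, hyG, -⟩
    dsimp only at hy0 hyG ⊢
    set r : ℝ := √(∑ i, y i ^ 2) with hr
    have hsum : 0 ≤ ∑ i, y i ^ 2 := Finset.sum_nonneg fun i _ => sq_nonneg _
    have hr2 : r ^ 2 = ∑ i, y i ^ 2 := Real.sq_sqrt hsum
    rcases (Real.sqrt_nonneg (∑ i, y i ^ 2)).eq_or_lt with h0 | hr0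
    · have hr0 : r = 0 := h0.symm
      rw [hr0] at hr2
      have hy : ∀ i, y i = 0 := by
        intro i
        have := (Finset.sum_eq_zero_iff_of_nonneg (fun i _ => sq_nonneg (y i))).mp
          (by rw [← hr2]; norm_num) i (Finset.mem_univ i)
        exact pow_eq_zero_iff (two_ne_zero) |>.mp this
      have hd0 : d ≠ 0 := by omega
      have hF : eval y F = 0 := by
        have h := hFhom.eval_mul_eq_pow_mul 0 y
        rw [zero_pow hd0, zero_mul] at h
        rwa [show y = fun i => 0 * y i from funext fun i => by simp [hy i]]
      simp [hF, hy 0, hd0]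
    · have hr0 : 0 < r := hr0
      have hmem : (fun i => r⁻¹ * y i) ∈ Kt := by
        rw [hKt]
        refine ⟨fun j => ?_, by positivity, ?_⟩
        · rw [(hGhom j).eval_mul_eq_pow_mul]
          exact mul_nonneg (by positivity) (hyG j)
        · simp only [mul_pow, ← Finset.mul_sum, ← hr2]
          field_simp
      have h := hKt_nonneg _ hmem
      rw [hFhom.eval_mul_eq_pow_mul, mul_pow, mul_left_comm, ← mul_sub] at h
      exact nonneg_of_mul_nonneg_right h (by positivity)
  · intro γ hγ
    set s : ℝ := 1 + ∑ i, xstar i ^ 2 with hs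
    have hs0 : 0 < s := by positivity
    set t : ℝ := (√s)⁻¹ with ht
    have ht0 : 0 < t := by positivity
    have hts : t ^ 2 * s = 1 := by
      rw [ht, inv_pow, Real.sq_sqrt hs0.le, inv_mul_cancel₀ hs0.ne']
    have hle : ∀ ℓ, t ^ 2 + ∑ i ∈ I ℓ, (t * xstar i) ^ 2 ≤ 1 := by
      intro ℓ
      have h1 : ∑ i ∈ I ℓ, xstar i ^ 2 ≤ ∑ i, xstar i ^ 2 :=
        Finset.sum_le_sum_of_subset_of_nonneg (Finset.subset_univ _) fun i _ _ => sq_nonneg _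
      simp only [mul_pow, ← Finset.mul_sum]
      nlinarith [mul_le_mul_of_nonneg_left h1 (sq_nonneg t)]
    have h := hγ (fun i => t * (Fin.cons 1 xstar : Fin (n + 1) → ℝ) i,
      fun ℓ => √(1 - (t ^ 2 + ∑ i ∈ I ℓ, (t * xstar i) ^ 2))) ⟨?_, fun j => ?_, fun ℓ => ?_⟩
    · simp only [hFhom.eval_mul_eq_pow_mul, hFdeh, hattain, Fin.cons_zero, mul_one] at h
      have h' : 0 ≤ t ^ d * (fmin - γ) := by linarith
      exact sub_nonneg.mp (nonneg_of_mul_nonneg_right h' (pow_pos ht0 d))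
    · simpa using ht0.le
    · simp only [(hGhom j).eval_mul_eq_pow_mul, hGdeh]
      exact mul_nonneg (by positivity) (hxK j)
    · simp only [Fin.cons_zero, Fin.cons_succ, mul_one]
      rw [Real.sq_sqrt (sub_nonneg.mpr (hle ℓ))]
      ring
end

section
/- Let f be a homogeneous real polynomial (form) of even degree d ≥ 2 in x_1,…,x_n with f(x) ≥ 0 for all x ∈ ℝⁿ, admitting a csp (x(1),…,x(p)) satisfying the RIP. Then for every ε > 0 there exist, for each ℓ ∈ {1,…,p}, a sum of squares σ_ℓ ∈ Σ[x(ℓ) ∪ {w_ℓ}] and a polynomial τ_ℓ ∈ ℝ[x(ℓ) ∪ {w_ℓ}] such that f + ε(Σ_{i=1}^n x_i^d + Σ_{ℓ=1}^p w_ℓ^d) = Σ_{ℓ=1}^p ( σ_ℓ + τ_ℓ·(Σ_{x_i∈x(ℓ)} x_i² + w_ℓ² − 1) ) as polynomials in x_1,…,x_n,w_1,…,w_p. -/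
open MvPolynomial

/-- `q` is a sum of squares of polynomials using only the variables in `A`. -/
def IsSOSOn {σ : Type*} [DecidableEq σ] (A : Finset σ) (q : MvPolynomial σ ℝ) : Prop :=
  ∃ (t : ℕ) (h : Fin t → MvPolynomial σ ℝ),
    (∀ i, (h i).vars ⊆ A) ∧ q = ∑ i, (h i) ^ 2

open Filter

/-- `u` converges to the bounded element `a` for the order seminorm defined by the cone `T`. -/
def ConeTendsto {R : Type*} [CommRing R] [Algebra ℝ R] (T : Subsemiring R) (u : ℕ → R) (a : R) :
    Prop :=
  (∃ M : ℝ, 0 < M ∧ algebraMap ℝ R M + a ∈ T ∧ algebraMap ℝ R M - a ∈ T) ∧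
  ∀ η : ℝ, 0 < η → ∀ᶠ N in atTop,
    algebraMap ℝ R η + (u N - a) ∈ T ∧ algebraMap ℝ R η - (u N - a) ∈ T

lemma sum_descFactorial_mul_bernstein {R : Type*} [CommRing R] (y : R) (a m : ℕ) :
    ∑ k ∈ Finset.range (a + m + 1),
      (k.descFactorial a : R) * ((a + m).choose k * y ^ k * (1 - y) ^ (a + m - k))
      = (a + m).descFactorial a * y ^ a := by
  rw [add_assoc, Finset.sum_range_add, Finset.sum_eq_zero, zero_add]
  · have h1 : (y + (1 - y)) ^ m = 1 := by simp
    rw [add_pow] at h1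
    conv_rhs => rw [← mul_one (y ^ a), ← h1, ← mul_assoc, Finset.mul_sum]
    refine Finset.sum_congr rfl fun j hj ↦ ?_
    have hj : j ≤ m := Nat.lt_succ_iff.mp (Finset.mem_range.mp hj)
    have key : (a + j).descFactorial a * (a + m).choose (a + j)
        = (a + m).descFactorial a * m.choose j := by
      rw [Nat.descFactorial_eq_factorial_mul_choose, Nat.descFactorial_eq_factorial_mul_choose,
        mul_assoc, mul_assoc]
      congr 1
      rw [mul_comm, Nat.choose_mul (Nat.le_add_right a j), Nat.add_sub_cancel_left,
        Nat.add_sub_cancel_left]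
    have key' : ((a + j).descFactorial a : R) * (a + m).choose (a + j)
        = (a + m).descFactorial a * m.choose j := by
      rw [← Nat.cast_mul, key, Nat.cast_mul]
    rw [show a + m - (a + j) = m - j by omega, pow_add]
    linear_combination (y ^ a * y ^ j * (1 - y) ^ (m - j)) * key'
  · intro k hk
    rw [Nat.descFactorial_eq_zero_iff_lt.mpr (Finset.mem_range.mp hk)]
    simp

lemma bernstein_mem_cone {R : Type*} [CommRing R] {T : Subsemiring R} {y : R} (hy : y ∈ T)
    (hy' : 1 - y ∈ T) (N k : ℕ) :
    (N.choose k : R) * y ^ k * (1 - y) ^ (N - k) ∈ T :=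
  T.mul_mem (T.mul_mem (natCast_mem T _) (T.pow_mem hy _)) (T.pow_mem hy' _)

lemma eventually_abs_pow_sub_descFactorial_div_le (a : ℕ) (η : ℝ) (hη : 0 < η) :
    ∀ᶠ N : ℕ in atTop, ∀ k ≤ N,
      |((k : ℝ) / N) ^ a - (k.descFactorial a : ℝ) / N.descFactorial a| ≤ η := by
  induction a generalizing η with
  | zero => simp [hη.le]
  | succ a ih =>
    have hlim : Tendsto (fun N : ℕ ↦ (a : ℝ) / ((N : ℝ) - a)) atTop (nhds 0) :=
      Tendsto.const_div_atTop (tendsto_atTop_add_const_right _ _ tendsto_natCast_atTop_atTop) _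
    filter_upwards [ih (η / 2) (by positivity), hlim.eventually (ge_mem_nhds (by positivity :
      (0 : ℝ) < η / 2)), eventually_gt_atTop a] with N h1 h2 hN k hk
    have hNa : (0 : ℝ) < N - a := by
      have : (a : ℝ) < N := by exact_mod_cast hN
      linarith
    have hN0 : (0 : ℝ) < N := by
      have : (0 : ℝ) ≤ a := by positivity
      linarith
    have hkN : (k : ℝ) ≤ N := by exact_mod_cast hk
    have hk0 : (0 : ℝ) ≤ k := by positivity
    set t : ℝ := k / N with ht
    set r : ℝ := (k.descFactorial a : ℝ) / N.descFactorial a with hr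
    have ht0 : 0 ≤ t := by positivity
    have ht1 : t ≤ 1 := by rw [ht, div_le_one hN0]; exact hkN
    have hD : (0 : ℝ) < N.descFactorial a := by
      exact_mod_cast Nat.descFactorial_pos.mpr hN.le
    have hr0 : 0 ≤ r := by positivity
    have hr1 : r ≤ 1 := by
      rw [hr, div_le_one hD]
      exact_mod_cast Nat.descFactorial_le a hk
    have hrec : (k.descFactorial (a + 1) : ℝ) / N.descFactorial (a + 1)
        = r * ((k - a) / (N - a)) := by
      rw [Nat.descFactorial_succ, Nat.descFactorial_succ]
      push_cast [Nat.cast_sub hN.le]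
      rcases le_or_gt a k with hak | hak
      · rw [Nat.cast_sub hak, hr]; field_simp
      · simp [hr, Nat.descFactorial_eq_zero_iff_lt.mpr hak]
    have hq : |t - ((k : ℝ) - a) / (N - a)| ≤ a / (N - a) := by
      have : t - ((k : ℝ) - a) / (N - a) = (a / (N - a)) * (1 - t) := by
        rw [ht]; field_simp; ring
      rw [this, abs_of_nonneg (by have := sub_nonneg.mpr ht1; positivity)]
      exact mul_le_of_le_one_right (by positivity) (by linarith)
    rw [hrec, show t ^ (a + 1) - r * ((k - a) / (N - a))
      = t * (t ^ a - r) + r * (t - (k - a) / (N - a)) by ring]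
    calc _ ≤ |t * (t ^ a - r)| + |r * (t - (k - a) / (N - a))| := abs_add_le _ _
      _ ≤ 1 * (η / 2) + 1 * (η / 2) := by
        rw [abs_mul, abs_mul, abs_of_nonneg ht0, abs_of_nonneg hr0]
        gcongr
        · exact h1 k hk
        · exact hq.trans h2
      _ = η := by ring

section Cone

variable {R : Type*} [CommRing R] [Algebra ℝ R] {T : Subsemiring R}

lemma cone_mul_bounds (hT : ∀ r : ℝ, 0 ≤ r → algebraMap ℝ R r ∈ T) {M N : ℝ} {a b : R}
    (ha : algebraMap ℝ R M + a ∈ T ∧ algebraMap ℝ R M - a ∈ T)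
    (hb : algebraMap ℝ R N + b ∈ T ∧ algebraMap ℝ R N - b ∈ T) :
    algebraMap ℝ R (M * N) + a * b ∈ T ∧ algebraMap ℝ R (M * N) - a * b ∈ T := by
  have hhalf : algebraMap ℝ R (1 / 2) ∈ T := hT _ (by norm_num)
  have h2 : algebraMap ℝ R (1 / 2) * 2 = 1 := by
    rw [← map_ofNat (algebraMap ℝ R) 2, ← map_mul]; norm_num
  constructor
  · have := T.mul_mem hhalf (T.add_mem (T.mul_mem ha.1 hb.1) (T.mul_mem ha.2 hb.2))
    convert this using 1
    rw [map_mul]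
    linear_combination (-(algebraMap ℝ R M * algebraMap ℝ R N + a * b)) * h2
  · have := T.mul_mem hhalf (T.add_mem (T.mul_mem ha.1 hb.2) (T.mul_mem ha.2 hb.1))
    convert this using 1
    rw [map_mul]
    linear_combination (-(algebraMap ℝ R M * algebraMap ℝ R N - a * b)) * h2

lemma cone_add_bounds {M N : ℝ} {a b : R}
    (ha : algebraMap ℝ R M + a ∈ T ∧ algebraMap ℝ R M - a ∈ T)
    (hb : algebraMap ℝ R N + b ∈ T ∧ algebraMap ℝ R N - b ∈ T) :
    algebraMap ℝ R (M + N) + (a + b) ∈ T ∧ algebraMap ℝ R (M + N) - (a + b) ∈ T := by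
  constructor
  · convert T.add_mem ha.1 hb.1 using 1
    rw [map_add]; ring
  · convert T.add_mem ha.2 hb.2 using 1
    rw [map_add]; ring

lemma ConeTendsto.const (hT : ∀ r : ℝ, 0 ≤ r → algebraMap ℝ R r ∈ T) (c : ℝ) :
    ConeTendsto T (fun _ ↦ algebraMap ℝ R c) (algebraMap ℝ R c) := by
  refine ⟨⟨|c| + 1, by positivity, ?_, ?_⟩, fun η hη ↦ .of_forall fun N ↦ ?_⟩
  · rw [← map_add]; exact hT _ (by linarith [neg_abs_le c])
  · rw [← map_sub]; exact hT _ (by linarith [le_abs_self c])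
  · simpa using hT η hη.le

lemma ConeTendsto.add {u v : ℕ → R} {a b : R}
    (hu : ConeTendsto T u a) (hv : ConeTendsto T v b) :
    ConeTendsto T (fun N ↦ u N + v N) (a + b) := by
  obtain ⟨⟨M, hM, ha⟩, hu⟩ := hu
  obtain ⟨⟨M', hM', hb⟩, hv⟩ := hv
  refine ⟨⟨M + M', by positivity, cone_add_bounds ha hb⟩, fun η hη ↦ ?_⟩
  filter_upwards [hu (η / 2) (by positivity), hv (η / 2) (by positivity)] with N h h'
  have := cone_add_bounds h h'
  rwa [add_halves, show u N - a + (v N - b) = u N + v N - (a + b) by ring] at this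

lemma ConeTendsto.mul (hT : ∀ r : ℝ, 0 ≤ r → algebraMap ℝ R r ∈ T) {u v : ℕ → R} {a b : R}
    (hu : ConeTendsto T u a) (hv : ConeTendsto T v b) :
    ConeTendsto T (fun N ↦ u N * v N) (a * b) := by
  obtain ⟨⟨M, hM, ha⟩, hu⟩ := hu
  obtain ⟨⟨M', hM', hb⟩, hv⟩ := hv
  refine ⟨⟨M * M', by positivity, cone_mul_bounds hT ha hb⟩, fun η hη ↦ ?_⟩
  filter_upwards [hu 1 one_pos, hv (η / 3) (by positivity), hu (η / (3 * M')) (by positivity),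
    hv (η / (3 * M)) (by positivity)] with N h₁ h₂ h₃ h₄
  have := cone_add_bounds (cone_add_bounds (cone_mul_bounds hT h₁ h₂) (cone_mul_bounds hT ha h₄))
    (cone_mul_bounds hT h₃ hb)
  rwa [show 1 * (η / 3) + M * (η / (3 * M)) + η / (3 * M') * M' = η by field_simp; norm_num,
    show (u N - a) * (v N - b) + a * (v N - b) + (u N - a) * b = u N * v N - a * b by ring] at this

lemma ConeTendsto.prod (hT : ∀ r : ℝ, 0 ≤ r → algebraMap ℝ R r ∈ T) {ι : Type*} (s : Finset ι)
    {u : ι → ℕ → R} {a : ι → R} (h : ∀ i ∈ s, ConeTendsto T (u i) (a i)) :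
    ConeTendsto T (fun N ↦ ∏ i ∈ s, u i N) (∏ i ∈ s, a i) := by
  classical
  induction s using Finset.induction_on with
  | empty => simpa using ConeTendsto.const hT (1 : ℝ)
  | insert i s hi ih =>
    simp only [Finset.prod_insert hi]
    exact (h i (by simp)).mul hT (ih fun j hj ↦ h j (by simp [hj]))

lemma coneTendsto_bernstein_pow (hT : ∀ r : ℝ, 0 ≤ r → algebraMap ℝ R r ∈ T) {y : R}
    (hy : y ∈ T) (hy' : 1 - y ∈ T) (a : ℕ) :
    ConeTendsto T (fun N ↦ ∑ k ∈ Finset.range (N + 1),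
      algebraMap ℝ R (((k : ℝ) / N) ^ a) * ((N.choose k : R) * y ^ k * (1 - y) ^ (N - k)))
      (y ^ a) := by
  refine ⟨⟨1, one_pos, ?_, ?_⟩, fun η hη ↦ ?_⟩
  · rw [map_one]; exact T.add_mem T.one_mem (T.pow_mem hy _)
  · rw [map_one, ← geom_sum_mul_neg]
    exact T.mul_mem (T.sum_mem fun i _ ↦ T.pow_mem hy _) hy'
  · filter_upwards [eventually_abs_pow_sub_descFactorial_div_le a η hη, eventually_ge_atTop a]
      with N h hN
    obtain ⟨m, rfl⟩ := Nat.exists_eq_add_of_le hN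
    have h1 : ∑ k ∈ Finset.range (a + m + 1),
        (((a + m).choose k : R) * y ^ k * (1 - y) ^ (a + m - k)) = 1 := by
      have := sum_descFactorial_mul_bernstein y 0 (a + m)
      simpa using this
    have hD : ((a + m).descFactorial a : ℝ) ≠ 0 := by
      exact_mod_cast (Nat.descFactorial_pos.mpr hN).ne'
    have h2 : ∑ k ∈ Finset.range (a + m + 1),
        algebraMap ℝ R ((k.descFactorial a : ℝ) / (a + m).descFactorial a) *
          (((a + m).choose k : R) * y ^ k * (1 - y) ^ (a + m - k)) = y ^ a := by
      have h3 := sum_descFactorial_mul_bernstein y a m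
      have h4 : algebraMap ℝ R (1 / (a + m).descFactorial a) * ((a + m).descFactorial a : R) = 1 := by
        rw [← map_natCast (algebraMap ℝ R), ← map_mul, one_div_mul_cancel hD, map_one]
      calc _ = algebraMap ℝ R (1 / (a + m).descFactorial a) * ∑ k ∈ Finset.range (a + m + 1),
          (k.descFactorial a : R) * ((a + m).choose k * y ^ k * (1 - y) ^ (a + m - k)) := by
            rw [Finset.mul_sum]
            refine Finset.sum_congr rfl fun k _ ↦ ?_
            rw [div_eq_mul_one_div, mul_comm (k.descFactorial a : ℝ), map_mul, map_natCast,
              mul_assoc]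
        _ = y ^ a := by rw [h3, ← mul_assoc, h4, one_mul]
    have hη1 : algebraMap ℝ R η = ∑ k ∈ Finset.range (a + m + 1),
        algebraMap ℝ R η * (((a + m).choose k : R) * y ^ k * (1 - y) ^ (a + m - k)) := by
      rw [← Finset.mul_sum, h1, mul_one]
    constructor
    · rw [← h2, hη1, ← Finset.sum_sub_distrib, ← Finset.sum_add_distrib]
      refine T.sum_mem fun k hk ↦ ?_
      rw [← sub_mul, ← map_sub, ← add_mul, ← map_add]
      have := abs_le.mp (h k (Nat.lt_succ_iff.mp (Finset.mem_range.mp hk)))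
      exact T.mul_mem (hT _ (by linarith)) (bernstein_mem_cone hy hy' _ _)
    · rw [← h2, hη1, ← Finset.sum_sub_distrib, ← Finset.sum_sub_distrib]
      refine T.sum_mem fun k hk ↦ ?_
      rw [← sub_mul, ← map_sub, ← sub_mul, ← map_sub]
      have := abs_le.mp (h k (Nat.lt_succ_iff.mp (Finset.mem_range.mp hk)))
      exact T.mul_mem (hT _ (by linarith)) (bernstein_mem_cone hy hy' _ _)

lemma coneTendsto_bernstein (hT : ∀ r : ℝ, 0 ≤ r → algebraMap ℝ R r ∈ T) {ι : Type*} [Fintype ι]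
    [DecidableEq ι] {y : ι → R} (hy : ∀ i, y i ∈ T) (hy' : ∀ i, 1 - y i ∈ T)
    (f : MvPolynomial ι ℝ) :
    ConeTendsto T (fun N ↦ ∑ k ∈ Fintype.piFinset fun _ : ι ↦ Finset.range (N + 1),
      algebraMap ℝ R (eval (fun i ↦ (k i : ℝ) / N) f) *
        ∏ i, ((N.choose (k i) : R) * y i ^ k i * (1 - y i) ^ (N - k i)))
      (aeval y f) := by
  induction f using MvPolynomial.induction_on' with
  | monomial u c =>
    convert (ConeTendsto.const hT c).mul hT (ConeTendsto.prod hT Finset.univ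
      fun i _ ↦ coneTendsto_bernstein_pow hT (hy i) (hy' i) (u i)) using 1
    · ext N
      rw [Finset.prod_univ_sum, Finset.mul_sum]
      refine Finset.sum_congr rfl fun k _ ↦ ?_
      rw [eval_monomial, Finsupp.prod_fintype _ _ (by simp), map_mul, map_prod,
        mul_assoc, ← Finset.prod_mul_distrib]
    · rw [aeval_monomial, Finsupp.prod_fintype _ _ (by simp)]
  | add p q hp hq =>
    convert hp.add hq using 1
    · ext N
      simp only [map_add, add_mul, Finset.sum_add_distrib]
    · rw [map_add]

/-- A polynomial that is positive on `[0, 1] ^ ι` takes values in the cone `T` at every tuple `y`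
satisfying `0 ≤ y ≤ 1` with respect to `T`. -/
lemma aeval_mem_cone_of_pos_on_unit_cube (hT : ∀ r : ℝ, 0 ≤ r → algebraMap ℝ R r ∈ T)
    {ι : Type*} [Fintype ι] {y : ι → R} (hy : ∀ i, y i ∈ T) (hy' : ∀ i, 1 - y i ∈ T)
    {f : MvPolynomial ι ℝ} (hf : ∀ x : ι → ℝ, (∀ i, x i ∈ Set.Icc 0 1) → 0 < eval x f) :
    aeval y f ∈ T := by
  classical
  obtain ⟨x₀, hx₀, hmin⟩ := (isCompact_univ_pi fun _ : ι ↦ isCompact_Icc (a := (0 : ℝ)) (b := 1))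
    |>.exists_isMinOn ⟨0, fun i _ ↦ ⟨le_rfl, zero_le_one⟩⟩ (continuous_eval f).continuousOn
  set δ := eval x₀ f with hδ
  have hδ0 : 0 < δ := hf x₀ fun i ↦ hx₀ i trivial
  obtain ⟨N, hN, hN0⟩ := (((coneTendsto_bernstein hT hy hy' (f - C δ)).2 δ hδ0).and
    (eventually_gt_atTop 0)).exists
  have hmem : ∑ k ∈ Fintype.piFinset fun _ : ι ↦ Finset.range (N + 1),
      algebraMap ℝ R (eval (fun i ↦ (k i : ℝ) / N) (f - C δ)) *
        ∏ i, ((N.choose (k i) : R) * y i ^ k i * (1 - y i) ^ (N - k i)) ∈ T := by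
    refine T.sum_mem fun k hk ↦ T.mul_mem (hT _ ?_)
      (T.prod_mem fun i _ ↦ bernstein_mem_cone (hy i) (hy' i) _ _)
    rw [map_sub, eval_C, sub_nonneg]
    refine hmin (Set.mem_univ_pi.mpr fun i ↦ ⟨by positivity, ?_⟩)
    rw [div_le_one (by exact_mod_cast hN0)]
    have := Finset.mem_range.mp (Fintype.mem_piFinset.mp hk i)
    exact_mod_cast Nat.lt_succ_iff.mp this
  have := T.add_mem hN.2 hmem
  rw [map_sub, aeval_C] at this
  convert this using 1
  ring

end Cone

section Cube

variable {σ : Type*}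

lemma eval_congr_vars {p : MvPolynomial σ ℝ} {x y : σ → ℝ} (h : ∀ i ∈ p.vars, x i = y i) :
    eval x p = eval y p :=
  eval₂Hom_congr' rfl (fun i hi _ ↦ h i hi) rfl

lemma isCompact_cube : IsCompact (Set.univ.pi fun _ : σ ↦ Set.Icc (-1 : ℝ) 1) :=
  isCompact_univ_pi fun _ ↦ isCompact_Icc

lemma zero_mem_cube : (0 : σ → ℝ) ∈ Set.univ.pi fun _ : σ ↦ Set.Icc (-1 : ℝ) 1 :=
  fun _ _ ↦ by norm_num

lemma exists_mvPolynomial_near_on_compact (φ : C(σ → ℝ, ℝ)) {K : Set (σ → ℝ)} (hK : IsCompact K)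
    {ε : ℝ} (hε : 0 < ε) : ∃ q : MvPolynomial σ ℝ, ∀ x ∈ K, |eval x q - φ x| < ε := by
  let Φ : MvPolynomial σ ℝ →ₐ[ℝ] C(σ → ℝ, ℝ) :=
    aeval fun i ↦ ⟨fun x ↦ x i, continuous_apply i⟩
  have hΦ (q : MvPolynomial σ ℝ) (x : σ → ℝ) : Φ q x = eval x q := by
    induction q using MvPolynomial.induction_on with
    | C a => simp [Φ]
    | add p q hp hq => simp [hp, hq]
    | mul_X p i hp => simp [hp, Φ]
  have hsep : Φ.range.SeparatesPoints := by
    intro x y hxy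
    obtain ⟨i, hi⟩ := Function.ne_iff.mp hxy
    exact ⟨Φ (X i), ⟨Φ (X i), ⟨X i, rfl⟩, rfl⟩, by simpa [hΦ] using hi⟩
  obtain ⟨_, ⟨q, rfl⟩, hq⟩ :=
    ContinuousMap.exists_mem_subalgebra_near_continuous_of_isCompact_of_separatesPoints hsep φ hK hε
  exact ⟨q, fun x hx ↦ by rw [← hΦ]; exact hq x hx⟩

/-- If `E + F` is positive on the cube, then a polynomial in the variables common to `E` and `F`
can be moved between `E` and `F` so that both become positive on the cube. -/
lemma exists_common_vars_pos_on_cube [DecidableEq σ] {A B : Finset σ} {E F : MvPolynomial σ ℝ}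
    (hE : E.vars ⊆ B) (hF : F.vars ⊆ A)
    (hpos : ∀ x ∈ Set.univ.pi fun _ : σ ↦ Set.Icc (-1 : ℝ) 1, 0 < eval x (E + F)) :
    ∃ q : MvPolynomial σ ℝ, q.vars ⊆ A ∩ B ∧
      ∀ x ∈ Set.univ.pi fun _ : σ ↦ Set.Icc (-1 : ℝ) 1,
        0 < eval x (E + q) ∧ 0 < eval x (F - q) := by
  set Q := Set.univ.pi fun _ : σ ↦ Set.Icc (-1 : ℝ) 1
  obtain ⟨x₀, hx₀, hmin⟩ := isCompact_cube.exists_isMinOn ⟨_, zero_mem_cube⟩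
    (continuous_eval (E + F)).continuousOn
  set δ := eval x₀ (E + F)
  have hδ : 0 < δ := hpos x₀ hx₀
  let merge (x z : σ → ℝ) : σ → ℝ := fun i ↦ if i ∈ A ∩ B then x i else z i
  have hmc : Continuous fun w : (σ → ℝ) × (σ → ℝ) ↦ merge w.1 w.2 := by
    refine continuous_pi fun i ↦ ?_
    simp only [merge]
    split_ifs <;> fun_prop
  have hφc : Continuous fun x ↦ sInf ((fun z ↦ eval (merge x z) F) '' Q) :=
    isCompact_cube.continuous_sInf ((continuous_eval F).comp hmc)
  set φ : C(σ → ℝ, ℝ) := ⟨_, hφc⟩ with hφ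
  have hφ_attained (x : σ → ℝ) : ∃ z ∈ Q, φ x = eval (merge x z) F ∧
      ∀ z' ∈ Q, eval (merge x z) F ≤ eval (merge x z') F :=
    isCompact_cube.exists_sInf_image_eq_and_le ⟨_, zero_mem_cube⟩
      ((continuous_eval F).comp (hmc.comp (by fun_prop : Continuous fun z ↦ (x, z)))).continuousOn
  have hφ_le (x) (hx : x ∈ Q) : φ x ≤ eval x F := by
    obtain ⟨z, -, h1, h2⟩ := hφ_attained x
    have hxx : merge x x = x := by ext i; simp [merge]
    simpa [h1, hxx] using h2 x hx
  have hφ_ge (x) (hx : x ∈ Q) : δ ≤ eval x E + φ x := by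
    obtain ⟨z, hz, h1, -⟩ := hφ_attained x
    let w : σ → ℝ := fun i ↦ if i ∈ B then x i else z i
    have hw : w ∈ Q := fun i _ ↦ by
      simp only [w]
      split_ifs
      exacts [hx i trivial, hz i trivial]
    have hwE : eval x E = eval w E := eval_congr_vars fun i hi ↦ by simp [w, hE hi]
    have hwF : eval (merge x z) F = eval w F :=
      eval_congr_vars fun i hi ↦ by simp [w, merge, hF hi]
    rw [h1, hwE, hwF, ← map_add]
    exact hmin hw
  obtain ⟨q, hq⟩ := exists_mvPolynomial_near_on_compact φ isCompact_cube (half_pos hδ)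
  let r : MvPolynomial σ ℝ :=
    aeval (fun i ↦ if i ∈ A ∩ B then X i else 0) q - C (δ / 2)
  have hr_eval (x) (hx : x ∈ Q) : |eval x r + δ / 2 - φ x| < δ / 2 := by
    have hx0 : merge x 0 ∈ Q := fun i _ ↦ by
      simp only [merge]
      split_ifs
      exacts [hx i trivial, zero_mem_cube i trivial]
    have h1 : eval x r + δ / 2 = eval (merge x 0) q := by
      simp only [r, map_sub, eval_C, sub_add_cancel]
      rw [← aeval_eq_eval, ← aeval_eq_eval, ← AlgHom.comp_apply, comp_aeval]
      congr 1
      ext i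
      simp only [merge, aeval_X]
      split_ifs <;> simp
    have h2 : φ (merge x 0) = φ x := by
      simp only [hφ, ContinuousMap.coe_mk]
      congr 2
      ext z
      congr 2
      ext i
      simp only [merge]
      split_ifs <;> rfl
    rw [h1, ← h2]
    exact hq _ hx0
  refine ⟨r, ?_, fun x hx ↦ ?_⟩
  · have : r ∈ supported ℝ (↑(A ∩ B) : Set σ) := by
      refine Subalgebra.sub_mem _ ?_ (Subalgebra.algebraMap_mem _ _)
      have : (aeval fun i ↦ if i ∈ A ∩ B then (X i : MvPolynomial σ ℝ) else 0) =
          (supported ℝ (↑(A ∩ B) : Set σ)).val.comp (aeval fun i ↦ if h : i ∈ A ∩ B then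
            ⟨X i, X_mem_supported.mpr (by exact_mod_cast h)⟩ else 0) := by
        ext1 i
        simp only [aeval_X, AlgHom.comp_apply]
        split_ifs <;> rfl
      rw [this]
      exact Subtype.property _
    exact_mod_cast mem_supported.mp this
  · have h1 := abs_lt.mp (hr_eval x hx)
    constructor
    · rw [map_add]
      linarith [hφ_ge x hx]
    · rw [map_sub (eval x) F r]
      linarith [hφ_le x hx]

/-- A sum of polynomials that is positive on the cube and has a sparsity pattern with the running
intersection property is a sum of polynomials with the same pattern, each positive on the cube. -/
lemma exists_sparse_pos_on_cube [DecidableEq σ] (A : ℕ → Finset σ) (m : ℕ)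
    (hA : ∀ ℓ < m, ∃ s ≤ ℓ, A (ℓ + 1) ∩ (Finset.range (ℓ + 1)).biUnion A ⊆ A s)
    (F : ℕ → MvPolynomial σ ℝ) (hF : ∀ ℓ ≤ m, (F ℓ).vars ⊆ A ℓ)
    (hpos : ∀ x ∈ Set.univ.pi fun _ : σ ↦ Set.Icc (-1 : ℝ) 1,
      0 < eval x (∑ ℓ ∈ Finset.range (m + 1), F ℓ)) :
    ∃ G : ℕ → MvPolynomial σ ℝ,
      ∑ ℓ ∈ Finset.range (m + 1), G ℓ = ∑ ℓ ∈ Finset.range (m + 1), F ℓ ∧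
      ∀ ℓ ≤ m, (G ℓ).vars ⊆ A ℓ ∧
        ∀ x ∈ Set.univ.pi fun _ : σ ↦ Set.Icc (-1 : ℝ) 1, 0 < eval x (G ℓ) := by
  induction m generalizing F with
  | zero =>
    refine ⟨F, rfl, fun ℓ hℓ ↦ ⟨hF ℓ hℓ, ?_⟩⟩
    obtain rfl : ℓ = 0 := by omega
    simpa using hpos
  | succ m ih =>
    rw [Finset.sum_range_succ] at hpos
    have hB : (∑ ℓ ∈ Finset.range (m + 1), F ℓ).vars ⊆ (Finset.range (m + 1)).biUnion A :=
      (vars_sum_subset _ _).trans (Finset.biUnion_mono fun ℓ hℓ ↦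
        hF ℓ (Finset.mem_range.mp hℓ).le)
    obtain ⟨q, hq, hqpos⟩ := exists_common_vars_pos_on_cube hB (hF (m + 1) le_rfl) hpos
    obtain ⟨s, hs, hAs⟩ := hA m (Nat.lt_succ_self m)
    obtain ⟨G, hGsum, hG⟩ := ih (fun ℓ hℓ ↦ hA ℓ (hℓ.trans (Nat.lt_succ_self m)))
      (F + Pi.single s q) (fun ℓ hℓ ↦ by
        rcases eq_or_ne ℓ s with rfl | hne
        · rw [Pi.add_apply, Pi.single_eq_same]
          exact (vars_add_subset _ _).trans
            (Finset.union_subset (hF _ (by omega)) (hq.trans hAs))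
        · rw [Pi.add_apply, Pi.single_eq_of_ne hne, add_zero]
          exact hF _ (by omega)) (fun x hx ↦ by
        simpa [Finset.sum_add_distrib, Finset.sum_pi_single', Nat.lt_succ_iff, hs] using
          (hqpos x hx).1)
    refine ⟨Function.update G (m + 1) (F (m + 1) - q), ?_, fun ℓ hℓ ↦ ?_⟩
    · rw [Finset.sum_range_succ, Function.update_self, Finset.sum_range_succ _ (m + 1),
        Finset.sum_congr rfl fun ℓ hℓ ↦ Function.update_of_ne (Finset.mem_range.mp hℓ).ne _ _,
        hGsum]
      simp [Finset.sum_add_distrib, Finset.sum_pi_single', hs]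
    · rcases eq_or_ne ℓ (m + 1) with rfl | hne
      · rw [Function.update_self]
        refine ⟨(vars_sub_subset _).trans (Finset.union_subset (hF _ le_rfl)
          (hq.trans Finset.inter_subset_left)), fun x hx ↦ (hqpos x hx).2⟩
      · rw [Function.update_of_ne hne]
        exact hG ℓ (by omega)

end Cube

lemma vars_subset_iff_mem_supported {σ : Type*} {A : Finset σ} {p : MvPolynomial σ ℝ} :
    p.vars ⊆ A ↔ p ∈ supported ℝ (A : Set σ) := by
  rw [mem_supported, Finset.coe_subset]

section SphereCone

variable {σ : Type*} [DecidableEq σ] {A : Finset σ}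

lemma isSOSOn_sum {κ : Type*} [Fintype κ] {h : κ → MvPolynomial σ ℝ}
    (hh : ∀ i, (h i).vars ⊆ A) : IsSOSOn A (∑ i, h i ^ 2) :=
  ⟨Fintype.card κ, h ∘ (Fintype.equivFin κ).symm, fun _ ↦ hh _,
    ((Fintype.equivFin κ).symm.sum_comp fun i ↦ h i ^ 2).symm⟩

lemma IsSOSOn.sq {q : MvPolynomial σ ℝ} (hq : q.vars ⊆ A) : IsSOSOn A (q ^ 2) :=
  ⟨1, fun _ ↦ q, fun _ ↦ hq, by simp⟩

lemma IsSOSOn.add {p q : MvPolynomial σ ℝ} (hp : IsSOSOn A p) (hq : IsSOSOn A q) :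
    IsSOSOn A (p + q) := by
  obtain ⟨t, h, hh, rfl⟩ := hp
  obtain ⟨t', h', hh', rfl⟩ := hq
  convert isSOSOn_sum (h := Sum.elim h h') (A := A) (by rintro (i | i) <;> simp [hh, hh']) using 1
  simp

lemma IsSOSOn.mul {p q : MvPolynomial σ ℝ} (hp : IsSOSOn A p) (hq : IsSOSOn A q) :
    IsSOSOn A (p * q) := by
  obtain ⟨t, h, hh, rfl⟩ := hp
  obtain ⟨t', h', hh', rfl⟩ := hq
  convert isSOSOn_sum (h := fun i : Fin t × Fin t' ↦ h i.1 * h' i.2) (A := A) (fun i ↦ ?_) using 1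
  · rw [Finset.sum_mul_sum, Fintype.sum_prod_type]
    simp only [mul_pow]
  · rw [vars_subset_iff_mem_supported]
    exact mul_mem (vars_subset_iff_mem_supported.mp (hh _))
      (vars_subset_iff_mem_supported.mp (hh' _))

lemma IsSOSOn.C {r : ℝ} (hr : 0 ≤ r) : IsSOSOn A (MvPolynomial.C r : MvPolynomial σ ℝ) := by
  convert IsSOSOn.sq (A := A) (q := MvPolynomial.C (√r)) (by simp) using 1
  rw [← map_pow, Real.sq_sqrt hr]

lemma IsSOSOn.mem_supported {p : MvPolynomial σ ℝ} (hp : IsSOSOn A p) :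
    p ∈ supported ℝ (A : Set σ) := by
  obtain ⟨t, h, hh, rfl⟩ := hp
  exact sum_mem fun i _ ↦ pow_mem (vars_subset_iff_mem_supported.mp (hh i)) 2

/-- The cone of polynomials in the variables `A` that are sums of squares modulo the ideal of the
unit sphere. -/
def sphereCone (A : Finset σ) : Subsemiring (MvPolynomial σ ℝ) where
  carrier := {p | ∃ s, IsSOSOn A s ∧ ∃ τ ∈ supported ℝ (A : Set σ),
    p = s + τ * (∑ j ∈ A, X j ^ 2 - 1)}
  zero_mem' := ⟨0, by simpa using IsSOSOn.C (A := A) le_rfl, 0, zero_mem _, by simp⟩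
  one_mem' := ⟨1, by simpa using IsSOSOn.C (A := A) zero_le_one, 0, zero_mem _, by simp⟩
  add_mem' := by
    rintro _ _ ⟨s, hs, τ, hτ, rfl⟩ ⟨s', hs', τ', hτ', rfl⟩
    exact ⟨s + s', hs.add hs', τ + τ', add_mem hτ hτ', by ring⟩
  mul_mem' := by
    rintro _ _ ⟨s, hs, τ, hτ, rfl⟩ ⟨s', hs', τ', hτ', rfl⟩
    refine ⟨s * s', hs.mul hs',
      s * τ' + τ * s' + τ * τ' * (∑ j ∈ A, X j ^ 2 - 1), ?_, by ring⟩
    refine add_mem (add_mem (mul_mem hs.mem_supported hτ') (mul_mem hτ hs'.mem_supported))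
      (mul_mem (mul_mem hτ hτ') (sub_mem (sum_mem fun j hj ↦ pow_mem ?_ 2) (one_mem _)))
    exact X_mem_supported.mpr hj

lemma IsSOSOn.mem_sphereCone {p : MvPolynomial σ ℝ} (hp : IsSOSOn A p) : p ∈ sphereCone A :=
  ⟨p, hp, 0, zero_mem _, by simp⟩

lemma half_mul_one_add_mem_sphereCone {i : σ} (hi : i ∈ A) {q : MvPolynomial σ ℝ}
    (hq : q = X i ∨ q = -X i) : MvPolynomial.C (1 / 2) * (1 + q) ∈ sphereCone A := by
  have hX (j : σ) (hj : j ∈ A) : (X j : MvPolynomial σ ℝ) ∈ supported ℝ (A : Set σ) :=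
    X_mem_supported.mpr hj
  have hqs : q ∈ supported ℝ (A : Set σ) := by
    rcases hq with rfl | rfl
    exacts [hX i hi, neg_mem (hX i hi)]
  have hq2 : q ^ 2 = X i ^ 2 := by rcases hq with rfl | rfl <;> ring
  refine mul_mem (IsSOSOn.C (by norm_num)).mem_sphereCone ?_
  have hmem : (1 + q) ^ 2 + ∑ j ∈ A.erase i, X j ^ 2 + (-1) * (∑ j ∈ A, X j ^ 2 - 1)
      ∈ sphereCone A := by
    refine add_mem (add_mem ?_ (sum_mem fun j hj ↦ ?_)) ?_
    · exact (IsSOSOn.sq (vars_subset_iff_mem_supported.mpr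
        (add_mem (one_mem _) hqs))).mem_sphereCone
    · exact (IsSOSOn.sq (vars_subset_iff_mem_supported.mpr
        (hX j (Finset.mem_of_mem_erase hj)))).mem_sphereCone
    · exact ⟨0, by simpa using IsSOSOn.C (A := A) le_rfl, -1, neg_mem (one_mem _), by simp⟩
  have h2 : (MvPolynomial.C (1 / 2) : MvPolynomial σ ℝ) * 2 = 1 := by
    rw [← map_ofNat (MvPolynomial.C : ℝ →+* MvPolynomial σ ℝ) 2, ← map_mul]; norm_num
  convert mul_mem (IsSOSOn.C (A := A) (by norm_num : (0 : ℝ) ≤ 1 / 2)).mem_sphereCone hmem using 1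
  rw [← Finset.add_sum_erase A _ hi]
  linear_combination (-(1 + q)) * h2 - MvPolynomial.C (1 / 2) * hq2

lemma mem_sphereCone_of_pos_on_cube [Fintype σ] {G : MvPolynomial σ ℝ} (hG : G.vars ⊆ A)
    (hpos : ∀ x ∈ Set.univ.pi fun _ : σ ↦ Set.Icc (-1 : ℝ) 1, 0 < eval x G) :
    G ∈ sphereCone A := by
  have h2 : (MvPolynomial.C (1 / 2) : MvPolynomial σ ℝ) * 2 = 1 := by
    rw [← map_ofNat (MvPolynomial.C : ℝ →+* MvPolynomial σ ℝ) 2, ← map_mul]; norm_num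
  let y : σ → MvPolynomial σ ℝ := fun i ↦ if i ∈ A then MvPolynomial.C (1 / 2) * (1 + X i) else 0
  have hy (i : σ) : y i ∈ sphereCone A := by
    simp only [y]
    split_ifs with hi
    exacts [half_mul_one_add_mem_sphereCone hi (.inl rfl), zero_mem _]
  have hy' (i : σ) : 1 - y i ∈ sphereCone A := by
    simp only [y]
    split_ifs with hi
    · convert half_mul_one_add_mem_sphereCone hi (.inr rfl) using 1
      linear_combination -h2
    · simp
  have hsub : aeval y (aeval (fun i ↦ 2 * X i - 1) G : MvPolynomial σ ℝ) = G := by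
    rw [← AlgHom.comp_apply, comp_aeval]
    conv_rhs => rw [← aeval_X_left_apply G]
    refine eval₂Hom_congr' rfl (fun i hi _ ↦ ?_) rfl
    simp only [map_sub, map_mul, map_one, aeval_X, map_ofNat, y, if_pos (hG hi)]
    linear_combination (1 + X i) * h2
  rw [← hsub]
  refine aeval_mem_cone_of_pos_on_unit_cube (fun r hr ↦ (IsSOSOn.C hr).mem_sphereCone) hy hy'
    fun x hx ↦ ?_
  rw [← aeval_eq_eval, ← AlgHom.comp_apply, comp_aeval, aeval_eq_eval]
  refine hpos _ fun i _ ↦ ?_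
  have := hx i
  simp only [map_sub, map_mul, map_one, aeval_X, map_ofNat]
  constructor <;> linarith [this.1, this.2]

end SphereCone

lemma exists_pos_add_mul_of_pos_on_zeros {X : Type*} [TopologicalSpace X] {K : Set X}
    (hK : IsCompact K) {g h : X → ℝ} (hg : Continuous g) (hh : Continuous h)
    (hnonneg : ∀ x ∈ K, 0 ≤ h x) (hpos : ∀ x ∈ K, h x = 0 → 0 < g x) :
    ∃ c : ℝ, ∀ x ∈ K, 0 < g x + c * h x := by
  have hK' : IsCompact (K ∩ {x | g x ≤ 0}) := hK.inter_right (isClosed_le hg continuous_const)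
  rcases (K ∩ {x | g x ≤ 0}).eq_empty_or_nonempty with hemp | hne
  · refine ⟨0, fun x hx ↦ ?_⟩
    by_contra hcon
    exact Set.notMem_empty x (hemp ▸ ⟨hx, by simpa using hcon⟩)
  · obtain ⟨a, ha, hmin⟩ := hK'.exists_isMinOn hne hg.continuousOn
    obtain ⟨b, hb, hmin'⟩ := hK'.exists_isMinOn hne hh.continuousOn
    have hhb : 0 < h b := (hnonneg b hb.1).lt_of_ne fun h0 ↦
      (hpos b hb.1 h0.symm).not_ge hb.2
    have hga : g a ≤ 0 := ha.2
    refine ⟨(1 - g a) / h b, fun x hx ↦ ?_⟩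
    rcases le_or_gt (g x) 0 with hgx | hgx
    · have h1 : g a ≤ g x := hmin ⟨hx, hgx⟩
      have h2 : h b ≤ h x := hmin' ⟨hx, hgx⟩
      have h3 : 1 - g a ≤ (1 - g a) / h b * h x := by
        rw [div_mul_eq_mul_div, le_div_iff₀ hhb]
        gcongr
        linarith
      linarith
    · have := mul_nonneg (div_nonneg (by linarith : 0 ≤ 1 - g a) hhb.le) (hnonneg x hx)
      linarith

/-- Sparse Positivstellensatz on a product of unit spheres whose variables satisfy the running
intersection property. -/
lemma exists_sparse_sos_of_pos_on_spheres {σ : Type*} [DecidableEq σ] [Fintype σ]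
    (A : ℕ → Finset σ) (m : ℕ)
    (hA : ∀ ℓ < m, ∃ s ≤ ℓ, A (ℓ + 1) ∩ (Finset.range (ℓ + 1)).biUnion A ⊆ A s)
    (F : ℕ → MvPolynomial σ ℝ) (hF : ∀ ℓ ≤ m, (F ℓ).vars ⊆ A ℓ)
    (hpos : ∀ x : σ → ℝ, (∀ ℓ ≤ m, ∑ j ∈ A ℓ, x j ^ 2 = 1) →
      0 < eval x (∑ ℓ ∈ Finset.range (m + 1), F ℓ)) :
    ∃ s τ : ℕ → MvPolynomial σ ℝ, (∀ ℓ ≤ m, IsSOSOn (A ℓ) (s ℓ)) ∧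
      (∀ ℓ ≤ m, (τ ℓ).vars ⊆ A ℓ) ∧
      ∑ ℓ ∈ Finset.range (m + 1), F ℓ =
        ∑ ℓ ∈ Finset.range (m + 1), (s ℓ + τ ℓ * (∑ j ∈ A ℓ, X j ^ 2 - 1)) := by
  let S (ℓ : ℕ) : MvPolynomial σ ℝ := ∑ j ∈ A ℓ, X j ^ 2 - 1
  have hS (ℓ : ℕ) : S ℓ ∈ supported ℝ (A ℓ : Set σ) :=
    sub_mem (sum_mem fun j hj ↦ pow_mem (X_mem_supported.mpr hj) 2) (one_mem _)
  obtain ⟨c, hc⟩ := exists_pos_add_mul_of_pos_on_zeros isCompact_cube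
    (continuous_eval (∑ ℓ ∈ Finset.range (m + 1), F ℓ))
    (continuous_eval (∑ ℓ ∈ Finset.range (m + 1), S ℓ ^ 2))
    (fun x _ ↦ by simpa using Finset.sum_nonneg fun _ _ ↦ sq_nonneg _)
    (fun x _ hx ↦ hpos x fun ℓ hℓ ↦ by
      rw [map_sum, Finset.sum_eq_zero_iff_of_nonneg
        (fun _ _ ↦ by rw [map_pow]; exact sq_nonneg _)] at hx
      have := hx ℓ (Finset.mem_range.mpr (Nat.lt_succ_iff.mpr hℓ))
      rw [map_pow, sq_eq_zero_iff] at this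
      simpa [S, sub_eq_zero] using this)
  obtain ⟨G, hGsum, hG⟩ := exists_sparse_pos_on_cube A m hA (fun ℓ ↦ F ℓ + C c * S ℓ ^ 2)
    (fun ℓ hℓ ↦ vars_subset_iff_mem_supported.mpr
      (add_mem (vars_subset_iff_mem_supported.mp (hF ℓ hℓ))
        (mul_mem (Subalgebra.algebraMap_mem _ _) (pow_mem (hS ℓ) 2))))
    (fun x hx ↦ by
      have := hc x hx
      rwa [← eval_C (f := x) c, ← map_mul, ← map_add, Finset.mul_sum,
        ← Finset.sum_add_distrib] at this)
  have hcone (ℓ : ℕ) : ∃ s τ : MvPolynomial σ ℝ, ℓ ≤ m → IsSOSOn (A ℓ) s ∧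
      τ ∈ supported ℝ (A ℓ : Set σ) ∧ G ℓ = s + τ * S ℓ := by
    by_cases hℓ : ℓ ≤ m
    · obtain ⟨s, hs, τ, hτ, h⟩ := mem_sphereCone_of_pos_on_cube (hG ℓ hℓ).1 (hG ℓ hℓ).2
      exact ⟨s, τ, fun _ ↦ ⟨hs, hτ, h⟩⟩
    · exact ⟨0, 0, fun h ↦ absurd h hℓ⟩
  choose s τ hsτ using hcone
  refine ⟨s, fun ℓ ↦ τ ℓ - C c * S ℓ, fun ℓ hℓ ↦ (hsτ ℓ hℓ).1, fun ℓ hℓ ↦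
    vars_subset_iff_mem_supported.mpr (sub_mem (hsτ ℓ hℓ).2.1
      (mul_mem (Subalgebra.algebraMap_mem _ _) (hS ℓ))), ?_⟩
  have hF_eq : ∑ ℓ ∈ Finset.range (m + 1), F ℓ =
      ∑ ℓ ∈ Finset.range (m + 1), (G ℓ - C c * S ℓ ^ 2) := by
    rw [Finset.sum_sub_distrib, hGsum, Finset.sum_add_distrib, add_sub_cancel_right]
  rw [hF_eq]
  refine Finset.sum_congr rfl fun ℓ hℓ ↦ ?_
  rw [(hsτ ℓ (Nat.lt_succ_iff.mp (Finset.mem_range.mp hℓ))).2.2]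
  simp only [S]
  ring

/-- Let `f` be a form of even degree `d ≥ 2` in `x_1,…,x_n` with
`f ≥ 0` on `ℝⁿ`, admitting a csp `(x(1),…,x(p))` satisfying the RIP. Then for every
`ε > 0` there exist, for each `ℓ`, an SOS `σ_ℓ ∈ Σ[x(ℓ)∪{w_ℓ}]` and
`τ_ℓ ∈ ℝ[x(ℓ)∪{w_ℓ}]` with
`f + ε(Σ_i x_i^d + Σ_ℓ w_ℓ^d) = Σ_ℓ (σ_ℓ + τ_ℓ·(Σ_{x_i∈x(ℓ)} x_i² + w_ℓ² − 1))`. -/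
theorem stmt_7
    (n p : ℕ) (hn : 1 ≤ n) (hp : 1 ≤ p)
    (f : MvPolynomial (Fin n) ℝ)
    (d : ℕ) (hd2 : 2 ≤ d) (hdeven : Even d)
    (hfhom : f.IsHomogeneous d)
    (hfnonneg : ∀ x : Fin n → ℝ, 0 ≤ eval x f)
    -- correlative sparsity pattern satisfying the RIP
    (I : Fin p → Finset (Fin n)) (hI : ∀ i : Fin n, ∃ ℓ : Fin p, i ∈ I ℓ)
    (fdec : Fin p → MvPolynomial (Fin n) ℝ)
    (hfdec : f = ∑ ℓ, fdec ℓ) (hfvars : ∀ ℓ, (fdec ℓ).vars ⊆ I ℓ)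
    (hRIP : ∀ (ℓ : Fin p) (h : (ℓ : ℕ) + 1 < p), ∃ s : Fin p, s ≤ ℓ ∧
      I ⟨(ℓ : ℕ) + 1, h⟩ ∩ (Finset.Iic ℓ).biUnion I ⊆ I s)
    -- variable cliques of the lifted problem
    (A : Fin p → Finset (Fin n ⊕ Fin p))
    (hA : ∀ ℓ, A ℓ = insert (Sum.inr ℓ) ((I ℓ).image Sum.inl))
    (ε : ℝ) (hε : 0 < ε) :
    ∃ (σ τ : Fin p → MvPolynomial (Fin n ⊕ Fin p) ℝ),
      (∀ ℓ, IsSOSOn (A ℓ) (σ ℓ)) ∧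
      (∀ ℓ, (τ ℓ).vars ⊆ A ℓ) ∧
      rename Sum.inl f
        + C ε * ((∑ i : Fin n, (X (Sum.inl i)) ^ d) + ∑ ℓ, (X (Sum.inr ℓ)) ^ d)
      = ∑ ℓ, (σ ℓ + τ ℓ * ((∑ i ∈ I ℓ, (X (Sum.inl i)) ^ 2)
          + (X (Sum.inr ℓ)) ^ 2 - 1)) := by

  classical
  obtain ⟨m, rfl⟩ : ∃ m, p = m + 1 := ⟨p - 1, by omega⟩
  choose c hc using hI
  let B (ℓ : ℕ) : Finset (Fin n ⊕ Fin (m + 1)) := A (Fin.ofNat (m + 1) ℓ)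
  let H (ℓ : Fin (m + 1)) : MvPolynomial (Fin n ⊕ Fin (m + 1)) ℝ :=
    rename Sum.inl (fdec ℓ) +
      C ε * (∑ i with c i = ℓ, X (Sum.inl i) ^ d + X (Sum.inr ℓ) ^ d)
  have hsum : ∑ ℓ ∈ Finset.range (m + 1), H (Fin.ofNat (m + 1) ℓ) = ∑ ℓ, H ℓ := by
    rw [Finset.sum_range]
    simp
  have hHsum : ∑ ℓ, H ℓ = rename Sum.inl f
      + C ε * ((∑ i : Fin n, (X (Sum.inl i)) ^ d) + ∑ ℓ, (X (Sum.inr ℓ)) ^ d) := by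
    simp only [H]
    rw [Finset.sum_add_distrib, ← Finset.mul_sum, Finset.sum_add_distrib, hfdec, map_sum,
      Finset.sum_fiberwise]
  have hHvars (ℓ : Fin (m + 1)) : (H ℓ).vars ⊆ A ℓ := by
    have hinl (i : Fin n) (hi : i ∈ I ℓ) : Sum.inl i ∈ A ℓ := by simp [hA, hi]
    have hinr : Sum.inr ℓ ∈ A ℓ := by simp [hA]
    rw [vars_subset_iff_mem_supported]
    refine add_mem (vars_subset_iff_mem_supported.mp fun j hj ↦ ?_)
      (mul_mem (Subalgebra.algebraMap_mem _ _) (add_mem (sum_mem fun i hi ↦ pow_mem ?_ d)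
        (pow_mem (X_mem_supported.mpr hinr) d)))
    · obtain ⟨i, hi, rfl⟩ := mem_vars_rename _ _ hj
      exact hinl i (hfvars ℓ hi)
    · obtain rfl := (Finset.mem_filter.mp hi).2
      exact X_mem_supported.mpr (hinl i (hc i))
  have hBRIP (ℓ : ℕ) (hℓ : ℓ < m) :
      ∃ s ≤ ℓ, B (ℓ + 1) ∩ (Finset.range (ℓ + 1)).biUnion B ⊆ B s := by
    obtain ⟨s, hs, hsub⟩ := hRIP ⟨ℓ, by omega⟩ (by simpa using hℓ)
    refine ⟨s, hs, fun j hj ↦ ?_⟩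
    obtain ⟨hj1, hj2⟩ := Finset.mem_inter.mp hj
    obtain ⟨k, hk, hjk⟩ := Finset.mem_biUnion.mp hj2
    have hk' : k < ℓ + 1 := Finset.mem_range.mp hk
    have e1 : Fin.ofNat (m + 1) (ℓ + 1) = ⟨ℓ + 1, by omega⟩ :=
      Fin.ext (Nat.mod_eq_of_lt (by omega))
    have e2 : Fin.ofNat (m + 1) k = ⟨k, by omega⟩ := Fin.ext (Nat.mod_eq_of_lt (by omega))
    simp only [B, e1, e2, hA, Fin.ofNat_val_eq_self] at hj1 hjk ⊢
    rcases j with i | r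
    · simp only [Finset.mem_insert, reduceCtorEq, Finset.mem_image, Sum.inl.injEq,
        exists_eq_right, false_or] at hj1 hjk ⊢
      exact hsub (Finset.mem_inter.mpr ⟨hj1, Finset.mem_biUnion.mpr
        ⟨⟨k, by omega⟩, Finset.mem_Iic.mpr (Fin.mk_le_mk.mpr (by omega)), hjk⟩⟩)
    · simp only [Finset.mem_insert, Sum.inr.injEq, Finset.mem_image, reduceCtorEq, and_false,
        exists_false, or_false] at hj1 hjk
      rw [hj1, Fin.mk.injEq] at hjk
      omega
  have hHpos (x : Fin n ⊕ Fin (m + 1) → ℝ) (hx : ∀ ℓ ≤ m, ∑ j ∈ B ℓ, x j ^ 2 = 1) :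
      0 < eval x (∑ ℓ ∈ Finset.range (m + 1), H (Fin.ofNat (m + 1) ℓ)) := by
    rw [hsum, hHsum]
    simp only [map_add, map_mul, eval_C, map_sum, map_pow, eval_X, eval_rename]
    have h0 := hfnonneg (x ∘ Sum.inl)
    have hd (j) : 0 ≤ x j ^ d := hdeven.pow_nonneg _
    obtain ⟨j, hj⟩ : ∃ j, x j ≠ 0 := by
      by_contra! hcon
      simpa [hcon] using hx 0 (Nat.zero_le m)
    have hj' : 0 < x j ^ d := hdeven.pow_pos hj
    have hall : 0 < ∑ j, x j ^ d :=
      Finset.sum_pos' (fun j _ ↦ hd j) ⟨j, Finset.mem_univ j, hj'⟩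
    rw [Fintype.sum_sum_type] at hall
    have := mul_pos hε hall
    linarith
  obtain ⟨s, τ, hs, hτ, heq⟩ := exists_sparse_sos_of_pos_on_spheres B m hBRIP
    (fun ℓ ↦ H (Fin.ofNat (m + 1) ℓ)) (fun ℓ _ ↦ hHvars _) hHpos
  have hBval (ℓ : Fin (m + 1)) : B ℓ = A ℓ := by simp only [B, Fin.ofNat_val_eq_self]
  refine ⟨fun ℓ ↦ s ℓ, fun ℓ ↦ τ ℓ, fun ℓ ↦ hBval ℓ ▸ hs ℓ (Nat.lt_succ_iff.mp ℓ.2),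
    fun ℓ ↦ hBval ℓ ▸ hτ ℓ (Nat.lt_succ_iff.mp ℓ.2), ?_⟩
  rw [← hHsum, ← hsum, heq, Finset.sum_range]
  refine Finset.sum_congr rfl fun ℓ _ ↦ ?_
  rw [hBval, hA, Finset.sum_insert (by simp), Finset.sum_image (by simp)]
  ring
end

section
/- Let f be a real polynomial in x_1,…,x_n of degree d with f(x) ≥ 0 for all x ∈ ℝⁿ, admitting a csp (x(1),…,x(p)) satisfying the RIP. Then for every ε > 0 there exist, for each ℓ ∈ {1,…,p}, a sum of squares σ_ℓ ∈ Σ[{x_0} ∪ x(ℓ) ∪ {w_ℓ}] and a polynomial τ_ℓ ∈ ℝ[{x_0} ∪ x(ℓ) ∪ {w_ℓ}] such that f̃ + ε(Σ_{i=0}^n x_i^d + Σ_{ℓ=1}^p w_ℓ^d) = Σ_{ℓ=1}^p ( σ_ℓ + τ_ℓ·(x_0² + Σ_{x_i∈x(ℓ)} x_i² + w_ℓ² − 1) ) as polynomials in x_0,x_1,…,x_n,w_1,…,w_p. -/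
open MvPolynomial

section Preordering

variable {R : Type*} [CommRing R]

/-- The subsemiring generated by a subsemiring `P` containing all squares and an element `b`. -/
def Subsemiring.adjoinElement (P : Subsemiring R) (hP : ∀ x, x * x ∈ P) (b : R) :
    Subsemiring R where
  carrier := {x | ∃ s ∈ P, ∃ t ∈ P, x = s + b * t}
  mul_mem' := by
    rintro _ _ ⟨s, hs, t, ht, rfl⟩ ⟨s', hs', t', ht', rfl⟩
    exact ⟨s * s' + b * b * (t * t'), P.add_mem (P.mul_mem hs hs')
      (P.mul_mem (hP b) (P.mul_mem ht ht')), s * t' + s' * t,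
      P.add_mem (P.mul_mem hs ht') (P.mul_mem hs' ht), by ring⟩
  one_mem' := ⟨1, P.one_mem, 0, P.zero_mem, by ring⟩
  add_mem' := by
    rintro _ _ ⟨s, hs, t, ht, rfl⟩ ⟨s', hs', t', ht', rfl⟩
    exact ⟨s + s', P.add_mem hs hs', t + t', P.add_mem ht ht', by ring⟩
  zero_mem' := ⟨0, P.zero_mem, 0, P.zero_mem, by ring⟩

theorem Subsemiring.le_adjoinElement (P : Subsemiring R) (hP : ∀ x, x * x ∈ P) (b : R) :
    P ≤ P.adjoinElement hP b :=
  fun x hx => ⟨x, hx, 0, P.zero_mem, by ring⟩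

theorem Subsemiring.mem_adjoinElement (P : Subsemiring R) (hP : ∀ x, x * x ∈ P) (b : R) :
    b ∈ P.adjoinElement hP b :=
  ⟨0, P.zero_mem, 1, P.one_mem, by ring⟩

/-- A proper preordering extends to a total one. -/
theorem Subsemiring.exists_total_extension (M : Subsemiring R) (hM : ∀ x, x * x ∈ M)
    (h1 : (-1 : R) ∉ M) :
    ∃ P : Subsemiring R, M ≤ P ∧ (-1 : R) ∉ P ∧ ∀ b, b ∈ P ∨ -b ∈ P := by
  obtain ⟨P, hMP, hmax⟩ := zorn_le_nonempty₀ {P : Subsemiring R | (-1 : R) ∉ P} (by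
    intro c hc hchain Q hQ
    refine ⟨sSup c, ?_, fun z hz => le_sSup hz⟩
    intro hmem
    obtain ⟨S, hS, hS1⟩ := (Subsemiring.mem_sSup_of_directedOn ⟨Q, hQ⟩ hchain.directedOn).1 hmem
    exact hc hS hS1) M h1
  have hP : ∀ x, x * x ∈ P := fun x => hMP (hM x)
  refine ⟨P, hMP, hmax.prop, fun b => ?_⟩
  have key : ∀ b, b ∉ P → ∃ s ∈ P, ∃ t ∈ P, (-1 : R) = s + b * t := by
    intro b hb
    by_contra hcon
    exact hb (hmax.le_of_ge (y := P.adjoinElement hP b) hcon (P.le_adjoinElement hP b)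
      (P.mem_adjoinElement hP b))
  by_contra! hb
  obtain ⟨s, hs, t, ht, h⟩ := key _ hb.1
  obtain ⟨s', hs', t', ht', h'⟩ := key _ hb.2
  apply hmax.prop
  have : (-1 : R) = s + s' + s * s' + b * b * (t * t') := by
    linear_combination (1 + s') * h - (b * t) * h'
  rw [this]
  exact P.add_mem (P.add_mem (P.add_mem hs hs') (P.mul_mem hs hs'))
    (P.mul_mem (hP b) (P.mul_mem ht ht'))

end Preordering

section Archimedean

variable {τ : Type*}

theorem C_mem_of_nonneg {P : Subsemiring (MvPolynomial τ ℝ)} (hP : ∀ x, x * x ∈ P) {r : ℝ}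
    (hr : 0 ≤ r) : C r ∈ P := by
  rw [← Real.mul_self_sqrt hr, C_mul]
  exact hP _

theorem mem_of_C_mul_mem {P : Subsemiring (MvPolynomial τ ℝ)} (hP : ∀ x, x * x ∈ P) {r : ℝ}
    (hr : 0 < r) {x : MvPolynomial τ ℝ} (hx : C r * x ∈ P) : x ∈ P := by
  have := P.mul_mem (C_mem_of_nonneg hP (inv_pos.2 hr).le) hx
  rwa [← mul_assoc, ← C_mul, inv_mul_cancel₀ hr.ne', C_1, one_mul] at this

/-- A preordering for which all variables are bounded is Archimedean. -/
theorem exists_bound_of_bounded_variables {P : Subsemiring (MvPolynomial τ ℝ)}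
    (hP : ∀ x, x * x ∈ P) (hX : ∀ i, 1 + X i ∈ P ∧ 1 - X i ∈ P) (b : MvPolynomial τ ℝ) :
    ∃ N : ℝ, 0 < N ∧ C N + b ∈ P ∧ C N - b ∈ P := by
  have hmul : ∀ b b' : MvPolynomial τ ℝ, (∃ N : ℝ, 0 < N ∧ C N + b ∈ P ∧ C N - b ∈ P) →
      (∃ N : ℝ, 0 < N ∧ C N + b' ∈ P ∧ C N - b' ∈ P) →
      ∃ N : ℝ, 0 < N ∧ C N + b * b' ∈ P ∧ C N - b * b' ∈ P := by
    rintro b b' ⟨N, hN, h1, h2⟩ ⟨N', hN', h1', h2'⟩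
    refine ⟨N * N', mul_pos hN hN', mem_of_C_mul_mem hP two_pos ?_, mem_of_C_mul_mem hP two_pos ?_⟩
    · convert! P.add_mem (P.mul_mem h1 h1') (P.mul_mem h2 h2') using 1
      simp only [C_mul, map_ofNat]; ring
    · convert! P.add_mem (P.mul_mem h1 h2') (P.mul_mem h2 h1') using 1
      simp only [C_mul, map_ofNat]; ring
  induction b using MvPolynomial.induction_on with
  | C a =>
    refine ⟨|a| + 1, by positivity, ?_, ?_⟩
    · rw [← C_add]
      exact C_mem_of_nonneg hP (by linarith [neg_abs_le a])
    · rw [← C_sub]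
      exact C_mem_of_nonneg hP (by linarith [le_abs_self a])
  | add p q hp hq =>
    obtain ⟨N, hN, h1, h2⟩ := hp
    obtain ⟨N', hN', h1', h2'⟩ := hq
    refine ⟨N + N', add_pos hN hN', ?_, ?_⟩
    · convert! P.add_mem h1 h1' using 1
      rw [C_add]; ring
    · convert! P.add_mem h2 h2' using 1
      rw [C_add]; ring
  | mul_X p i hp => exact hmul _ _ hp ⟨1, one_pos, by simpa using hX i⟩

/-- The polynomials that are infinitesimal with respect to the preordering `P`. -/
def IsInfinitesimal (P : Subsemiring (MvPolynomial τ ℝ)) (u : MvPolynomial τ ℝ) : Prop :=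
  ∀ ε : ℝ, 0 < ε → C ε + u ∈ P ∧ C ε - u ∈ P

theorem IsInfinitesimal.add {P : Subsemiring (MvPolynomial τ ℝ)} {u v : MvPolynomial τ ℝ}
    (hu : IsInfinitesimal P u) (hv : IsInfinitesimal P v) : IsInfinitesimal P (u + v) := by
  intro ε hε
  have h1 := hu _ (half_pos hε)
  have h2 := hv _ (half_pos hε)
  have hC : (C ε : MvPolynomial τ ℝ) = C (ε / 2) + C (ε / 2) := by rw [← C_add, add_halves]
  constructor
  · convert! P.add_mem h1.1 h2.1 using 1
    rw [hC]; ring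
  · convert! P.add_mem h1.2 h2.2 using 1
    rw [hC]; ring

theorem IsInfinitesimal.mul {P : Subsemiring (MvPolynomial τ ℝ)} (hP : ∀ x, x * x ∈ P)
    {u b : MvPolynomial τ ℝ} (hu : IsInfinitesimal P u)
    (hb : ∃ N : ℝ, 0 < N ∧ C N + b ∈ P ∧ C N - b ∈ P) : IsInfinitesimal P (u * b) := by
  intro ε hε
  obtain ⟨N, hN, h1, h2⟩ := hb
  obtain ⟨hu1, hu2⟩ := hu (ε / N) (div_pos hε hN)
  have hC : (C ε : MvPolynomial τ ℝ) = C (ε / N) * C N := by rw [← C_mul, div_mul_cancel₀ _ hN.ne']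
  constructor
  · refine mem_of_C_mul_mem hP two_pos ?_
    convert! P.add_mem (P.mul_mem hu1 h1) (P.mul_mem hu2 h2) using 1
    rw [hC, map_ofNat]; ring
  · refine mem_of_C_mul_mem hP two_pos ?_
    convert! P.add_mem (P.mul_mem hu2 h1) (P.mul_mem hu1 h2) using 1
    rw [hC, map_ofNat]; ring

/-- Every element bounded with respect to a proper total preordering has a standard part. -/
theorem exists_sub_C_isInfinitesimal {P : Subsemiring (MvPolynomial τ ℝ)} (hP : ∀ x, x * x ∈ P)
    (h1 : (-1 : MvPolynomial τ ℝ) ∉ P) (htot : ∀ b, b ∈ P ∨ -b ∈ P) {b : MvPolynomial τ ℝ}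
    (hb : ∃ N : ℝ, 0 < N ∧ C N + b ∈ P ∧ C N - b ∈ P) :
    ∃ r : ℝ, IsInfinitesimal P (b - C r) := by
  obtain ⟨N, hN, hN1, hN2⟩ := hb
  have hneg : ∀ r : ℝ, r < 0 → C r ∉ P := by
    intro r hr hmem
    apply h1
    refine mem_of_C_mul_mem hP (neg_pos.2 hr) ?_
    simpa using hmem
  set S : Set ℝ := {r | b - C r ∈ P} with hS
  have hne : S.Nonempty := ⟨-N, by simpa [hS, add_comm] using hN1⟩
  have hbdd : BddAbove S := by
    refine ⟨N, fun r hr => ?_⟩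
    by_contra! hlt
    apply hneg (N - r) (by linarith)
    convert! P.add_mem hN2 hr using 1
    rw [C_sub]; ring
  refine ⟨sSup S, fun ε hε => ⟨?_, ?_⟩⟩
  · obtain ⟨r, hr, hlt⟩ := exists_lt_of_lt_csSup hne (show sSup S - ε < sSup S by linarith)
    convert! P.add_mem hr (C_mem_of_nonneg hP (show 0 ≤ r - (sSup S - ε) by linarith)) using 1
    simp only [C_sub]; ring
  · have hnot : sSup S + ε ∉ S := fun h => by linarith [le_csSup hbdd h]
    convert! (htot (b - C (sSup S + ε))).resolve_left hnot using 1
    rw [C_add]; ring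

/-- **Archimedean representation theorem**, properness part: if `P` is a proper preordering in which
all variables are bounded, then there is a point at which all elements of `P` are nonnegative. -/
theorem exists_point_of_neg_one_notMem {P : Subsemiring (MvPolynomial τ ℝ)}
    (hP : ∀ x, x * x ∈ P) (hX : ∀ i, 1 + X i ∈ P ∧ 1 - X i ∈ P)
    (h1 : (-1 : MvPolynomial τ ℝ) ∉ P) :
    ∃ v : τ → ℝ, ∀ q ∈ P, 0 ≤ eval v q := by
  obtain ⟨Q, hPQ, hQ1, htot⟩ := P.exists_total_extension hP h1
  have hQ : ∀ x, x * x ∈ Q := fun x => hPQ (hP x)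
  have hbd := exists_bound_of_bounded_variables hQ fun i => ⟨hPQ (hX i).1, hPQ (hX i).2⟩
  choose v hv using fun i : τ => exists_sub_C_isInfinitesimal hQ hQ1 htot (hbd (X i))
  have hinf : ∀ q : MvPolynomial τ ℝ, IsInfinitesimal Q (q - C (eval v q)) := by
    intro q
    induction q using MvPolynomial.induction_on with
    | C a =>
      intro ε hε
      simpa using C_mem_of_nonneg hQ hε.le
    | add p q hp hq =>
      convert! hp.add hq using 1
      simp only [map_add]; ring
    | mul_X p i hp =>
      convert! (hp.mul hQ (hbd (X i))).add ((hv i).mul hQ (hbd (C (eval v p)))) using 1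
      simp only [map_mul, eval_X]; ring
  refine ⟨v, fun q hq => ?_⟩
  by_contra! hlt
  apply hQ1
  have h2 := (hinf q (-(eval v q) / 2) (by linarith)).2
  refine mem_of_C_mul_mem hQ (show 0 < -(eval v q) / 2 by linarith) ?_
  convert! Q.add_mem h2 (hPQ hq) using 1
  have : (C (eval v q) : MvPolynomial τ ℝ) = - (C (-(eval v q) / 2) + C (-(eval v q) / 2)) := by
    rw [← C_add, ← C_neg]; congr 1; ring
  rw [this]; ring

/-- **Archimedean representation theorem** (Krivine, Stone, Kadison, Dubois). -/
theorem mem_of_eval_pos {M : Subsemiring (MvPolynomial τ ℝ)}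
    (hM : ∀ x, x * x ∈ M) (hX : ∀ i, 1 + X i ∈ M ∧ 1 - X i ∈ M) {a : MvPolynomial τ ℝ}
    (ha : ∀ v : τ → ℝ, (∀ q ∈ M, 0 ≤ eval v q) → 0 < eval v a) : a ∈ M := by
  have hmem : (-1 : MvPolynomial τ ℝ) ∈ M.adjoinElement hM (-a) := by
    by_contra hcon
    have hle := M.le_adjoinElement hM (-a)
    obtain ⟨v, hv⟩ := exists_point_of_neg_one_notMem (fun x => hle (hM x))
      (fun i => ⟨hle (hX i).1, hle (hX i).2⟩) hcon
    have h1 := ha v fun q hq => hv q (hle hq)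
    have h2 := hv _ (M.mem_adjoinElement hM (-a))
    rw [map_neg] at h2
    linarith
  obtain ⟨m, hm, t, ht, h⟩ := hmem
  obtain ⟨k, hk, -, hkt⟩ := exists_bound_of_bounded_variables hM hX t
  obtain ⟨N, hN, hNa, -⟩ := exists_bound_of_bounded_variables hM hX a
  have step : ∀ r : ℝ, 0 ≤ r → a + C r ∈ M → a + C (r - 1 / k) ∈ M := by
    intro r hr hra
    refine mem_of_C_mul_mem hM (mul_pos hk hk) ?_
    have hC : (C (r - 1 / k) * C k : MvPolynomial τ ℝ) = C r * C k - 1 := by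
      rw [← C_mul, sub_mul, div_mul_cancel₀ _ hk.ne', C_sub, C_mul, C_1]
    have hkt2 : C k + (C k - t) ∈ M := M.add_mem (C_mem_of_nonneg hM hk.le) hkt
    convert! M.add_mem (M.add_mem (M.add_mem (M.mul_mem (hM (C k - t)) hra) hkt)
      (M.mul_mem hkt2 hm)) (M.mul_mem (C_mem_of_nonneg hM hr) (M.mul_mem ht hkt2)) using 1
    rw [C_mul]
    linear_combination (C k) * hC + (2 * C k - t) * h
  have iter : ∀ j : ℕ, ∃ r : ℝ, r ≤ max 0 (N - j * (1 / k)) ∧ a + C r ∈ M := by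
    intro j
    induction j with
    | zero => exact ⟨N, by simp, by rwa [add_comm]⟩
    | succ j ih =>
      obtain ⟨r, hr, hra⟩ := ih
      rcases le_or_gt r 0 with h0 | h0
      · exact ⟨r, h0.trans (le_max_left _ _), hra⟩
      · refine ⟨r - 1 / k, ?_, step r h0.le hra⟩
        have : r ≤ N - j * (1 / k) := (le_max_iff.1 hr).resolve_left (by linarith)
        refine le_max_of_le_right ?_
        push_cast
        linarith
  obtain ⟨j, hj⟩ := exists_nat_gt (N / (1 / k))
  obtain ⟨r, hr, hra⟩ := iter j
  have hk' : 0 < 1 / k := by positivity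
  rw [div_lt_iff₀ hk'] at hj
  rw [max_eq_left (by linarith)] at hr
  convert! M.add_mem hra (C_mem_of_nonneg hM (neg_nonneg.2 hr)) using 1
  rw [C_neg]; ring

end Archimedean

section Sphere

variable {τ : Type*}

/-- The preordering of polynomials that are sums of squares modulo a polynomial `g`. -/
def sumSqMod (g : MvPolynomial τ ℝ) : Subsemiring (MvPolynomial τ ℝ) where
  carrier := {q | ∃ s, IsSumSq s ∧ ∃ t, q = s + t * g}
  mul_mem' := by
    rintro _ _ ⟨s, hs, t, rfl⟩ ⟨s', hs', t', rfl⟩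
    exact ⟨s * s', hs.mul hs', s * t' + s' * t + t * t' * g, by ring⟩
  one_mem' := ⟨1, IsSumSq.one, 0, by ring⟩
  add_mem' := by
    rintro _ _ ⟨s, hs, t, rfl⟩ ⟨s', hs', t', rfl⟩
    exact ⟨s + s', hs.add hs', t + t', by ring⟩
  zero_mem' := ⟨0, IsSumSq.zero, 0, by ring⟩

/-- A polynomial that is positive on the unit sphere is a sum of squares modulo the equation
of the sphere. -/
theorem exists_sumSq_add_mul_sphere [Fintype τ] (q : MvPolynomial τ ℝ)
    (hq : ∀ v : τ → ℝ, ∑ i, v i ^ 2 = 1 → 0 < eval v q) :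
    ∃ s, IsSumSq s ∧ ∃ t, q = s + t * (∑ i, X i ^ 2 - 1) := by
  classical
  set g : MvPolynomial τ ℝ := ∑ i, X i ^ 2 - 1 with hg
  have hsq : ∀ x, x * x ∈ sumSqMod g := fun x => ⟨x * x, IsSumSq.mul_self x, 0, by ring⟩
  have hX2 : ∀ i, 1 - X i * X i ∈ sumSqMod g := by
    intro i
    refine ⟨∑ j ∈ Finset.univ.erase i, X j ^ 2, IsSumSq.sum_sq _ _, -1, ?_⟩
    rw [hg, ← Finset.add_sum_erase _ _ (Finset.mem_univ i)]
    ring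
  refine mem_of_eval_pos (M := sumSqMod g) hsq (fun i => ⟨?_, ?_⟩) fun v hv => hq v ?_
  · refine mem_of_C_mul_mem hsq two_pos ?_
    convert! (sumSqMod g).add_mem (hsq (1 + X i)) (hX2 i) using 1
    rw [map_ofNat]; ring
  · refine mem_of_C_mul_mem hsq two_pos ?_
    convert! (sumSqMod g).add_mem (hsq (1 - X i)) (hX2 i) using 1
    rw [map_ofNat]; ring
  · have h1 := hv g ⟨0, IsSumSq.zero, 1, by ring⟩
    have h2 := hv (-g) ⟨0, IsSumSq.zero, -1, by ring⟩
    simp only [hg, map_neg, map_sub, map_sum, map_pow, eval_X, map_one] at h1 h2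
    linarith

end Sphere

section Sparse

variable {V : Type*}

theorem eval_eq_of_eqOn_vars {q : MvPolynomial V ℝ} {u v : V → ℝ}
    (h : ∀ i ∈ q.vars, u i = v i) : eval u q = eval v q :=
  eval₂Hom_congr' rfl (fun i hi _ => h i hi) rfl

/-- Polynomials are dense in the continuous functions on a compact set of a coordinate space. -/
theorem exists_polynomial_near_of_isCompact (h : C(V → ℝ, ℝ)) {K : Set (V → ℝ)}
    (hK : IsCompact K) {δ : ℝ} (hδ : 0 < δ) :
    ∃ q : MvPolynomial V ℝ, ∀ y ∈ K, |eval y q - h y| < δ := by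
  let Φ : MvPolynomial V ℝ →ₐ[ℝ] C(V → ℝ, ℝ) :=
    aeval fun i => ⟨fun y => y i, continuous_apply i⟩
  have hΦ : ∀ q y, Φ q y = eval y q := by
    intro q y
    induction q using MvPolynomial.induction_on with
    | C a => simp [Φ]
    | add p q hp hq => simp [hp, hq]
    | mul_X p i hp => simp [hp, Φ]
  have hsep : Φ.range.SeparatesPoints := by
    intro x y hxy
    obtain ⟨i, hi⟩ := Function.ne_iff.1 hxy
    exact ⟨_, ⟨Φ (X i), ⟨X i, rfl⟩, rfl⟩, by simpa [hΦ] using hi⟩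
  obtain ⟨g, ⟨q, rfl⟩, hg⟩ :=
    ContinuousMap.exists_mem_subalgebra_near_continuous_of_isCompact_of_separatesPoints
      hsep h hK hδ
  refine ⟨q, fun y hy => ?_⟩
  have := hg y hy
  rwa [Real.norm_eq_abs, AlgHom.toRingHom_eq_coe, RingHom.coe_coe, hΦ] at this

theorem isClosed_exists_fiber {E Y : Type*} [TopologicalSpace E] [TopologicalSpace Y] [T2Space Y]
    {K : Set E} (hK : IsCompact K) {π : E → Y} (hπ : Continuous π) {φ : E → ℝ}
    (hφ : Continuous φ) (c : ℝ) : IsClosed {y | ∃ z ∈ K, π z = y ∧ φ z ≤ c} := by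
  have : {y | ∃ z ∈ K, π z = y ∧ φ z ≤ c} = π '' (K ∩ {z | φ z ≤ c}) := by
    ext y
    simp only [Set.mem_ofPred_eq, Set.mem_image, Set.mem_inter_iff]
    exact ⟨fun ⟨z, h1, h2, h3⟩ => ⟨z, ⟨h1, h3⟩, h2⟩, fun ⟨z, ⟨h1, h3⟩, h2⟩ => ⟨z, h1, h2, h3⟩⟩
  rw [this]
  exact ((hK.inter_right (isClosed_le hφ continuous_const)).image hπ).isClosed

theorem exists_lt_on_compact {E : Type*} [TopologicalSpace E] {K : Set E} (hK : IsCompact K)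
    {φ : E → ℝ} (hφ : ContinuousOn φ K) {c : ℝ} (h : ∀ z ∈ K, c < φ z) :
    ∃ m, c < m ∧ ∀ z ∈ K, m ≤ φ z := by
  rcases K.eq_empty_or_nonempty with rfl | hne
  · exact ⟨c + 1, by linarith, by simp⟩
  · obtain ⟨z, hz, hmin⟩ := hK.exists_isMinOn hne hφ
    exact ⟨φ z, h z hz, fun w hw => hmin hw⟩

/-- If `φ + ψ > 0` on the fibre product of the compact sets `K` and `L` over `Y`,
then a continuous function on `Y` separates `-ψ` from `φ`. -/
theorem exists_continuous_separating {E Y : Type*} [TopologicalSpace E] [TopologicalSpace Y]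
    [T2Space Y] [NormalSpace Y] [ParacompactSpace Y] {K L : Set E} (hK : IsCompact K)
    (hL : IsCompact L) {π : E → Y} (hπ : Continuous π) {φ ψ : E → ℝ} (hφ : Continuous φ)
    (hψ : Continuous ψ) (hpos : ∀ z ∈ K, ∀ w ∈ L, π z = π w → 0 < φ z + ψ w) :
    ∃ h : C(Y, ℝ), (∀ z ∈ K, h (π z) < φ z) ∧ ∀ w ∈ L, 0 < h (π w) + ψ w := by
  let t : Y → Set ℝ := fun y =>
    {c | (∀ z ∈ K, π z = y → c < φ z) ∧ ∀ w ∈ L, π w = y → 0 < c + ψ w}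
  have hconv : ∀ y, Convex ℝ (t y) := by
    intro y
    rw [convex_iff_ordConnected]
    exact ⟨fun a ha b hb c hc => ⟨fun z hz hzy => hc.2.trans_lt (hb.1 z hz hzy),
      fun w hw hwy => (ha.2 w hw hwy).trans_le (by linarith [hc.1])⟩⟩
  have hloc : ∀ y, ∃ c : ℝ, ∀ᶠ y' in nhds y, c ∈ t y' := by
    intro y
    have hfib : IsClosed (π ⁻¹' {y}) := isClosed_singleton.preimage hπ
    obtain ⟨c, hc⟩ : (t y).Nonempty := by
      rcases (K ∩ π ⁻¹' {y}).eq_empty_or_nonempty with hemp | hne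
      · obtain ⟨m, hm⟩ := ((hL.image hψ).bddBelow)
        refine ⟨-m + 1, fun z hz hzy => ?_, fun w hw _ => ?_⟩
        · exact absurd (show z ∈ K ∩ π ⁻¹' {y} from ⟨hz, hzy⟩) (by simp [hemp])
        · linarith [hm (Set.mem_image_of_mem ψ hw)]
      · obtain ⟨z, ⟨hz, hzy⟩, hmin⟩ := (hK.inter_right hfib).exists_isMinOn hne hφ.continuousOn
        obtain ⟨m, hm0, hm⟩ := exists_lt_on_compact (hL.inter_right hfib) hψ.continuousOn
          (c := -φ z) fun w hw => by linarith [hpos z hz w hw.1 (hzy.trans hw.2.symm)]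
        refine ⟨(φ z - m) / 2, fun z' hz' hzy' => ?_, fun w hw hwy => ?_⟩
        · have : φ z ≤ φ z' := hmin ⟨hz', hzy'⟩
          linarith
        · linarith [hm w ⟨hw, hwy⟩]
    refine ⟨c, ?_⟩
    have h1 := (isClosed_exists_fiber hK hπ hφ c).isOpen_compl.mem_nhds (x := y) (by
      rintro ⟨z, hz, hzy, hle⟩
      exact absurd (hc.1 z hz hzy) (not_lt.2 hle))
    have h2 := (isClosed_exists_fiber hL hπ hψ (-c)).isOpen_compl.mem_nhds (x := y) (by
      rintro ⟨z, hz, hzy, hle⟩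
      linarith [hc.2 z hz hzy])
    filter_upwards [h1, h2] with y' h1 h2
    refine ⟨fun z hz hzy => ?_, fun w hw hwy => ?_⟩
    · by_contra! hle
      exact h1 ⟨z, hz, hzy, hle⟩
    · by_contra! hle
      exact h2 ⟨w, hw, hwy, by linarith⟩
  obtain ⟨h, hh⟩ := exists_continuous_forall_mem_convex_of_local_const hconv hloc
  exact ⟨h, fun z hz => (hh _).1 z hz rfl, fun w hw => (hh _).2 w hw rfl⟩

theorem exists_polynomial_separating [Finite V] [DecidableEq V] (Y : Finset V)
    {K L : Set (V → ℝ)} (hK : IsCompact K) (hL : IsCompact L) (φ ψ : MvPolynomial V ℝ)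
    (hpos : ∀ z ∈ K, ∀ w ∈ L, (∀ i ∈ Y, z i = w i) → 0 < eval z φ + eval w ψ) :
    ∃ q : MvPolynomial V ℝ, q.vars ⊆ Y ∧ (∀ z ∈ K, 0 < eval z (φ - q)) ∧
      ∀ w ∈ L, 0 < eval w (ψ + q) := by
  let π : (V → ℝ) → (Y → ℝ) := fun v i => v i
  have hπ : Continuous π := by fun_prop
  have hcont : ∀ q : MvPolynomial V ℝ, Continuous fun v : V → ℝ => eval v q :=
    fun q => MvPolynomial.continuous_eval q
  obtain ⟨h, h1, h2⟩ := exists_continuous_separating hK hL hπ (hcont φ) (hcont ψ)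
    fun z hz w hw hzw => hpos z hz w hw fun i hi => congrFun hzw ⟨i, hi⟩
  have hhπ : Continuous fun v => h (π v) := h.continuous.comp hπ
  obtain ⟨m, hm0, hm⟩ := exists_lt_on_compact hK ((hcont φ).sub hhπ).continuousOn (c := 0)
    fun z hz => sub_pos.2 (h1 z hz)
  obtain ⟨m', hm0', hm'⟩ := exists_lt_on_compact hL (hhπ.add (hcont ψ)).continuousOn (c := 0) h2
  obtain ⟨q, hq⟩ := exists_polynomial_near_of_isCompact h ((hK.image hπ).union (hL.image hπ))
    (lt_min hm0 hm0')
  have heval : ∀ v, eval v (rename Subtype.val q) = eval (π v) q := fun v => by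
    rw [eval_rename]; rfl
  refine ⟨rename Subtype.val q, ?_, fun z hz => ?_, fun w hw => ?_⟩
  · refine (vars_rename _ _).trans fun i hi => ?_
    obtain ⟨j, -, rfl⟩ := Finset.mem_image.1 hi
    exact j.2
  · have h3 := (abs_lt.1 (hq (π z) (Or.inl ⟨z, hz, rfl⟩))).2
    have h4 : m ≤ eval z φ - h (π z) := hm z hz
    rw [map_sub, heval]
    linarith [min_le_left m m']
  · have h3 := (abs_lt.1 (hq (π w) (Or.inr ⟨w, hw, rfl⟩))).1
    have h4 : m' ≤ h (π w) + eval w ψ := hm' w hw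
    rw [map_add, heval]
    linarith [min_le_right m m']

/-- A sum of polynomials along cliques with the running intersection property that is positive on
the common zero set in the cube can be rewritten so that every summand is positive. -/
theorem exists_sparse_positive_decomposition [Finite V] [DecidableEq V] (A : ℕ → Finset V)
    (g : ℕ → MvPolynomial V ℝ) (hg : ∀ ℓ, (g ℓ).vars ⊆ A ℓ) (m : ℕ)
    (hRIP : ∀ ℓ, ℓ + 1 < m → ∃ s ≤ ℓ, A (ℓ + 1) ∩ (Finset.range (ℓ + 1)).biUnion A ⊆ A s)
    (P : ℕ → MvPolynomial V ℝ) (hP : ∀ ℓ < m, (P ℓ).vars ⊆ A ℓ)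
    (hpos : ∀ v ∈ Set.Icc (-1 : V → ℝ) 1, (∀ ℓ < m, eval v (g ℓ) = 0) →
      0 < m → 0 < eval v (∑ ℓ ∈ Finset.range m, P ℓ)) :
    ∃ Q : ℕ → MvPolynomial V ℝ, (∀ ℓ < m, (Q ℓ).vars ⊆ A ℓ) ∧
      ∑ ℓ ∈ Finset.range m, Q ℓ = ∑ ℓ ∈ Finset.range m, P ℓ ∧
      ∀ ℓ < m, ∀ v ∈ Set.Icc (-1 : V → ℝ) 1, eval v (g ℓ) = 0 → 0 < eval v (Q ℓ) := by
  induction m generalizing P with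
  | zero => exact ⟨P, by simp, rfl, by simp⟩
  | succ m ih =>
    rcases Nat.eq_zero_or_pos m with rfl | hm
    · refine ⟨P, hP, rfl, fun ℓ hℓ v hv hgv => ?_⟩
      obtain rfl : ℓ = 0 := by omega
      simpa using hpos v hv (fun j hj => by rwa [show j = 0 by omega]) one_pos
    obtain ⟨s, hs, hsA⟩ := hRIP (m - 1) (by omega)
    rw [Nat.sub_add_cancel hm] at hsA
    set Y := A m ∩ (Finset.range m).biUnion A with hY
    have hcont : ∀ q : MvPolynomial V ℝ, Continuous fun v : V → ℝ => eval v q :=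
      fun q => MvPolynomial.continuous_eval q
    have hzero : ∀ ℓ, IsClosed {v : V → ℝ | eval v (g ℓ) = 0} := fun ℓ =>
      isClosed_eq (hcont _) continuous_const
    have hK : IsCompact (Set.Icc (-1 : V → ℝ) 1 ∩ {v | eval v (g m) = 0}) :=
      isCompact_Icc.inter_right (hzero m)
    have hL : IsCompact (Set.Icc (-1 : V → ℝ) 1 ∩ {v | ∀ ℓ < m, eval v (g ℓ) = 0}) := by
      refine isCompact_Icc.inter_right ?_
      simp only [Set.ofPred_forall]
      exact isClosed_iInter fun ℓ => isClosed_iInter fun _ => hzero ℓ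
    obtain ⟨q, hqY, hq1, hq2⟩ := exists_polynomial_separating Y hK hL (P m)
      (∑ ℓ ∈ Finset.range m, P ℓ) (by
        rintro z ⟨hz, hzg⟩ w ⟨hw, hwg⟩ hzw
        let u : V → ℝ := fun i => if i ∈ A m then z i else w i
        have hum : ∀ i ∈ A m, u i = z i := fun i hi => if_pos hi
        have hul : ∀ ℓ < m, ∀ i ∈ A ℓ, u i = w i := by
          intro ℓ hℓ i hi
          by_cases him : i ∈ A m
          · rw [hum i him]
            exact hzw i (Finset.mem_inter.2 ⟨him, Finset.mem_biUnion.2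
              ⟨ℓ, Finset.mem_range.2 hℓ, hi⟩⟩)
          · exact if_neg him
        have huB : u ∈ Set.Icc (-1 : V → ℝ) 1 := by
          constructor <;> intro i <;> by_cases hi : i ∈ A m <;> simp only [u, hi, if_true, if_false]
          exacts [hz.1 i, hw.1 i, hz.2 i, hw.2 i]
        have h0 := hpos u huB (fun ℓ hℓ => by
          rcases Nat.lt_succ_iff_lt_or_eq.1 hℓ with h | rfl
          · rw [eval_eq_of_eqOn_vars fun i hi => hul ℓ h i (hg ℓ hi)]
            exact hwg ℓ h
          · rw [eval_eq_of_eqOn_vars fun i hi => hum i (hg _ hi)]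
            exact hzg) m.succ_pos
        rw [Finset.sum_range_succ, map_add, map_sum] at h0
        rw [eval_eq_of_eqOn_vars fun i hi => hum i (hP m m.lt_succ_self hi),
          Finset.sum_congr rfl fun ℓ hℓ => eval_eq_of_eqOn_vars (v := w) fun i hi =>
            hul ℓ (Finset.mem_range.1 hℓ) i (hP ℓ (by simp at hℓ; omega) hi)] at h0
        rw [map_sum]
        linarith)
    have hsm : s ∈ Finset.range m := Finset.mem_range.2 (by omega)
    have hsum : ∑ ℓ ∈ Finset.range m, (P ℓ + if ℓ = s then q else 0) =
        ∑ ℓ ∈ Finset.range m, P ℓ + q := by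
      rw [Finset.sum_add_distrib, Finset.sum_ite_eq' _ s, if_pos hsm]
    obtain ⟨Q, hQA, hQsum, hQpos⟩ := ih (fun ℓ hℓ => hRIP ℓ (by omega))
      (fun ℓ => P ℓ + if ℓ = s then q else 0)
      (fun ℓ hℓ => by
        split_ifs with h
        · subst h
          exact (vars_add_subset _ _).trans
            (Finset.union_subset (hP ℓ (by omega)) (hqY.trans hsA))
        · rw [add_zero]
          exact hP ℓ (by omega))
      (fun v hv hvg _ => by
        rw [hsum]
        exact hq2 v ⟨hv, hvg⟩)
    refine ⟨fun ℓ => if ℓ < m then Q ℓ else P m - q, fun ℓ hℓ => ?_, ?_, fun ℓ hℓ v hv hvg => ?_⟩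
    · dsimp only
      split_ifs with h
      · exact hQA ℓ h
      · obtain rfl : ℓ = m := by omega
        exact (vars_sub_subset _).trans (Finset.union_subset (hP ℓ ℓ.lt_succ_self)
          (hqY.trans Finset.inter_subset_left))
    · rw [Finset.sum_range_succ, Finset.sum_range_succ, if_neg (lt_irrefl m),
        Finset.sum_congr rfl fun ℓ hℓ => if_pos (Finset.mem_range.1 hℓ), hQsum, hsum]
      ring
    · dsimp only
      split_ifs with h
      · exact hQpos ℓ h v hv hvg
      · obtain rfl : ℓ = m := by omega
        exact hq1 v ⟨hv, hvg⟩

end Sparse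

section SphereOn

variable {V : Type*} [DecidableEq V]

theorem IsSumSq.isSOSOn_rename {A : Finset V} {s : MvPolynomial A ℝ} (hs : IsSumSq s) :
    IsSOSOn A (rename Subtype.val s) := by
  induction hs with
  | zero => exact ⟨0, Fin.elim0, fun i => i.elim0, by simp⟩
  | sq_add a hs ih =>
    obtain ⟨t, h, hh, hsum⟩ := ih
    refine ⟨t + 1, Fin.cons (rename Subtype.val a) h, fun i => ?_, ?_⟩
    · refine Fin.cases ?_ (fun i => by simpa using hh i) i
      rw [Fin.cons_zero]
      refine (vars_rename _ _).trans fun i hi => ?_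
      obtain ⟨j, -, rfl⟩ := Finset.mem_image.1 hi
      exact j.2
    · rw [Fin.sum_univ_succ, map_add, hsum, map_mul]
      simp [sq]

theorem exists_isSOSOn_add_mul_sphere (A : Finset V) {Q : MvPolynomial V ℝ} (hQ : Q.vars ⊆ A)
    (hpos : ∀ v ∈ Set.Icc (-1 : V → ℝ) 1,
      eval v (∑ i ∈ A, X i ^ 2 - 1 : MvPolynomial V ℝ) = 0 → 0 < eval v Q) :
    ∃ σ τ : MvPolynomial V ℝ, IsSOSOn A σ ∧ τ.vars ⊆ A ∧
      Q = σ + τ * (∑ i ∈ A, X i ^ 2 - 1) := by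
  obtain ⟨q, rfl⟩ := exists_rename_eq_of_vars_subset_range Q (Subtype.val : A → V)
    Subtype.val_injective (by simpa using hQ)
  obtain ⟨s, hs, t, rfl⟩ := exists_sumSq_add_mul_sphere q (by
    intro v hv
    let u : V → ℝ := fun i => if h : i ∈ A then v ⟨i, h⟩ else 0
    have huv : u ∘ Subtype.val = v := by
      ext i
      simp [u]
    have hbd : ∀ i, u i ^ 2 ≤ 1 := by
      intro i
      by_cases h : i ∈ A
      · simp only [u, h, dif_pos]
        rw [← hv]
        exact Finset.single_le_sum (f := fun i => v i ^ 2) (fun i _ => sq_nonneg _)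
          (Finset.mem_univ (⟨i, h⟩ : A))
      · simp [u, h]
    have h0 := hpos u ⟨fun i => (abs_le.1 ((sq_le_one_iff_abs_le_one _).1 (hbd i))).1,
      fun i => (abs_le.1 ((sq_le_one_iff_abs_le_one _).1 (hbd i))).2⟩ (by
        simp only [map_sub, map_sum, map_pow, eval_X, map_one]
        rw [← Finset.sum_coe_sort A, sub_eq_zero, ← hv]
        exact Finset.sum_congr rfl fun i _ => by simp [u])
    rwa [eval_rename, huv] at h0)
  refine ⟨rename Subtype.val s, rename Subtype.val t, hs.isSOSOn_rename, ?_, ?_⟩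
  · refine (vars_rename _ _).trans fun i hi => ?_
    obtain ⟨j, -, rfl⟩ := Finset.mem_image.1 hi
    exact j.2
  · simp only [map_add, map_mul, map_sub, map_sum, map_pow, rename_X, map_one]
    rw [Finset.sum_coe_sort A fun i => (X i : MvPolynomial V ℝ) ^ 2]

end SphereOn

section Homogenization

theorem MvPolynomial.IsHomogeneous.eval_smul {τ : Type*} {F : MvPolynomial τ ℝ} {d : ℕ}
    (hF : F.IsHomogeneous d) (c : ℝ) (v : τ → ℝ) : eval (c • v) F = c ^ d * eval v F := by
  rw [eval_eq, eval_eq, Finset.mul_sum]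
  refine Finset.sum_congr rfl fun m hm => ?_
  have hdeg := hF (mem_support_iff.1 hm)
  simp only [Finsupp.weight_apply, Pi.one_apply, smul_eq_mul, mul_one] at hdeg
  simp only [Pi.smul_apply, smul_eq_mul, mul_pow]
  rw [Finset.prod_mul_distrib, Finset.prod_pow_eq_pow_sum]
  rw [Finsupp.sum] at hdeg
  rw [hdeg]
  ring

variable {n : ℕ}

/-- The homogenization to degree `d` of the part of `f` of degree at most `d`. -/
noncomputable def homogenizeTo (d : ℕ) (f : MvPolynomial (Fin n) ℝ) :
    MvPolynomial (Fin (n + 1)) ℝ :=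
  ∑ k ∈ Finset.range (d + 1), X 0 ^ (d - k) * rename Fin.succ (homogeneousComponent k f)

theorem homogenizeTo_sum {ι : Type*} (s : Finset ι) (d : ℕ) (f : ι → MvPolynomial (Fin n) ℝ) :
    homogenizeTo d (∑ i ∈ s, f i) = ∑ i ∈ s, homogenizeTo d (f i) := by
  simp only [homogenizeTo, map_sum, Finset.mul_sum]
  exact Finset.sum_comm

theorem homogenizeTo_isHomogeneous (d : ℕ) (f : MvPolynomial (Fin n) ℝ) :
    (homogenizeTo d f).IsHomogeneous d := by
  refine IsHomogeneous.sum _ _ _ fun k hk => ?_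
  have := ((isHomogeneous_X ℝ (0 : Fin (n + 1))).pow (d - k)).mul
    ((homogeneousComponent_isHomogeneous k f).rename_isHomogeneous (f := Fin.succ))
  rwa [one_mul, Nat.sub_add_cancel (Nat.lt_succ_iff.1 (Finset.mem_range.1 hk))] at this

theorem vars_homogeneousComponent_subset {τ : Type*} (k : ℕ) (f : MvPolynomial τ ℝ) :
    (homogeneousComponent k f).vars ⊆ f.vars := by
  intro i hi
  rw [mem_vars_iff_mem_support] at hi ⊢
  obtain ⟨m, hm, him⟩ := hi
  rw [support_homogeneousComponent] at hm
  exact ⟨m, (Finset.mem_filter.1 hm).1, him⟩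

theorem vars_homogenizeTo_subset (d : ℕ) (f : MvPolynomial (Fin n) ℝ) :
    (homogenizeTo d f).vars ⊆ insert 0 (f.vars.image Fin.succ) := by
  refine (vars_sum_subset _ _).trans (Finset.biUnion_subset.2 fun k _ => ?_)
  refine (vars_mul _ _).trans (Finset.union_subset ?_ ?_)
  · refine (vars_pow _ _).trans ?_
    simp
  · exact ((vars_rename _ _).trans (Finset.image_subset_image
      (vars_homogeneousComponent_subset k f))).trans (Finset.subset_insert _ _)

theorem eval_cons_one_homogenizeTo (f : MvPolynomial (Fin n) ℝ) (x : Fin n → ℝ) :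
    eval (Fin.cons 1 x : Fin (n + 1) → ℝ) (homogenizeTo f.totalDegree f) = eval x f := by
  conv_rhs => rw [← sum_homogeneousComponent f]
  have hx : (Fin.cons 1 x : Fin (n + 1) → ℝ) ∘ Fin.succ = x := by ext i; simp
  simp [homogenizeTo, eval_rename, hx]

theorem eval_cons_zero_homogenizeTo (d : ℕ) (f : MvPolynomial (Fin n) ℝ) (x : Fin n → ℝ) :
    eval (Fin.cons 0 x : Fin (n + 1) → ℝ) (homogenizeTo d f) =
      eval x (homogeneousComponent d f) := by
  have hx : (Fin.cons 0 x : Fin (n + 1) → ℝ) ∘ Fin.succ = x := by ext i; simp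
  rw [homogenizeTo, Finset.sum_range_succ, map_add, map_sum, Finset.sum_eq_zero]
  · simp [eval_rename, hx]
  · intro k hk
    have : d - k ≠ 0 := by have := Finset.mem_range.1 hk; omega
    simp [this]

theorem cons_eq_smul_cons_one {t : ℝ} (ht : t ≠ 0) (x : Fin n → ℝ) :
    (Fin.cons t x : Fin (n + 1) → ℝ) = t • (Fin.cons 1 (t⁻¹ • x) : Fin (n + 1) → ℝ) := by
  ext i
  refine Fin.cases ?_ (fun i => ?_) i
  · simp
  · simp [ht]

theorem MvPolynomial.IsHomogeneous.eq_of_eval_cons_one {F G : MvPolynomial (Fin (n + 1)) ℝ} {d : ℕ}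
    (hF : F.IsHomogeneous d) (hG : G.IsHomogeneous d)
    (h : ∀ x : Fin n → ℝ,
      eval (Fin.cons 1 x : Fin (n + 1) → ℝ) F = eval (Fin.cons 1 x : Fin (n + 1) → ℝ) G) :
    F = G := by
  refine mul_left_cancel₀ (X_ne_zero (0 : Fin (n + 1))) (MvPolynomial.funext fun v => ?_)
  rw [← Fin.cons_self_tail v]
  by_cases h0 : v 0 = 0
  · simp [h0]
  · rw [cons_eq_smul_cons_one h0, map_mul, map_mul, hF.eval_smul, hG.eval_smul, h]

variable {d : ℕ} {F : MvPolynomial (Fin (n + 1)) ℝ}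

theorem eval_cons_nonneg (hF : F.IsHomogeneous d)
    (hpos : ∀ x : Fin n → ℝ, 0 ≤ eval (Fin.cons 1 x : Fin (n + 1) → ℝ) F) {t : ℝ} (ht : 0 ≤ t)
    (x : Fin n → ℝ) : 0 ≤ eval (Fin.cons t x : Fin (n + 1) → ℝ) F := by
  have hlt : ∀ t : ℝ, 0 < t → 0 ≤ eval (Fin.cons t x : Fin (n + 1) → ℝ) F := by
    intro t ht
    rw [cons_eq_smul_cons_one ht.ne', hF.eval_smul]
    exact mul_nonneg (pow_nonneg ht.le _) (hpos _)
  have hcont : Continuous fun t : ℝ => eval (Fin.cons t x : Fin (n + 1) → ℝ) F := by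
    refine (MvPolynomial.continuous_eval F).comp (continuous_pi fun i => ?_)
    refine Fin.cases ?_ (fun i => ?_) i
    · simpa using continuous_id'
    · simpa using continuous_const
  have hclosed := isClosed_le (continuous_const (y := (0 : ℝ))) hcont
  have hsub := hclosed.closure_subset_iff.2 (show Set.Ioi (0 : ℝ) ⊆ _ from hlt)
  rw [closure_Ioi] at hsub
  exact hsub ht

theorem homogeneousComponent_totalDegree_ne_zero {τ : Type*} {f : MvPolynomial τ ℝ} (hf : f ≠ 0) :
    homogeneousComponent f.totalDegree f ≠ 0 := by
  obtain ⟨m, hm, hsup⟩ := Finset.exists_mem_eq_sup f.support (support_nonempty.2 hf)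
    fun m => m.sum fun _ e => e
  intro h0
  have h1 : m ∈ (homogeneousComponent f.totalDegree f).support := by
    rw [support_homogeneousComponent, Finset.mem_filter]
    exact ⟨hm, hsup.symm⟩
  simp [h0] at h1

/-- A polynomial that is nonnegative everywhere has even degree. -/
theorem even_totalDegree_of_nonneg {f : MvPolynomial (Fin n) ℝ} (hf : ∀ x, 0 ≤ eval x f) :
    Even f.totalDegree := by
  by_contra hodd
  rw [Nat.not_even_iff_odd] at hodd
  have hf0 : f ≠ 0 := by
    rintro rfl
    simp at hodd
  have htop : ∀ x, 0 ≤ eval x (homogeneousComponent f.totalDegree f) := by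
    intro x
    rw [← eval_cons_zero_homogenizeTo]
    exact eval_cons_nonneg (homogenizeTo_isHomogeneous _ _)
      (fun x => by rw [eval_cons_one_homogenizeTo]; exact hf x) le_rfl x
  refine homogeneousComponent_totalDegree_ne_zero hf0 (MvPolynomial.funext fun x => ?_)
  have h1 := htop ((-1 : ℝ) • x)
  rw [(homogeneousComponent_isHomogeneous _ f).eval_smul, hodd.neg_one_pow] at h1
  rw [map_zero]
  linarith [htop x]

theorem eval_nonneg_of_even (hF : F.IsHomogeneous d) (hd : Even d)
    (hpos : ∀ x : Fin n → ℝ, 0 ≤ eval (Fin.cons 1 x : Fin (n + 1) → ℝ) F) (v : Fin (n + 1) → ℝ) :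
    0 ≤ eval v F := by
  rcases le_total 0 (v 0) with h | h
  · rw [← Fin.cons_self_tail v]
    exact eval_cons_nonneg hF hpos h _
  · have h1 := eval_cons_nonneg hF hpos (t := (-v) 0) (by simpa using h) (Fin.tail (-v))
    rw [Fin.cons_self_tail, ← neg_one_smul ℝ v, hF.eval_smul, hd.neg_one_pow, one_mul] at h1
    exact h1

end Homogenization

/-- Let `f` be a real polynomial in `x_1,…,x_n` of degree `d` with
`f ≥ 0` on `ℝⁿ`, admitting a csp `(x(1),…,x(p))` satisfying the RIP. Then for every
`ε > 0` there exist, for each `ℓ`, an SOS `σ_ℓ ∈ Σ[{x₀}∪x(ℓ)∪{w_ℓ}]` and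
`τ_ℓ ∈ ℝ[{x₀}∪x(ℓ)∪{w_ℓ}]` with
`f̃ + ε(Σ_{i=0}^n x_i^d + Σ_ℓ w_ℓ^d)
  = Σ_ℓ (σ_ℓ + τ_ℓ·(x₀² + Σ_{x_i∈x(ℓ)} x_i² + w_ℓ² − 1))`. -/
theorem stmt_9
    (n p : ℕ) (hn : 1 ≤ n) (hp : 1 ≤ p)
    (f : MvPolynomial (Fin n) ℝ)
    (d : ℕ) (hd : d = f.totalDegree)
    (hfnonneg : ∀ x : Fin n → ℝ, 0 ≤ eval x f)
    -- homogenization of f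
    (F : MvPolynomial (Fin (n + 1)) ℝ)
    (hFhom : F.IsHomogeneous d)
    (hFdeh : ∀ x : Fin n → ℝ, eval (Fin.cons 1 x) F = eval x f)
    -- correlative sparsity pattern satisfying the RIP
    (I : Fin p → Finset (Fin n)) (hI : ∀ i : Fin n, ∃ ℓ : Fin p, i ∈ I ℓ)
    (fdec : Fin p → MvPolynomial (Fin n) ℝ)
    (hfdec : f = ∑ ℓ, fdec ℓ) (hfvars : ∀ ℓ, (fdec ℓ).vars ⊆ I ℓ)
    (hRIP : ∀ (ℓ : Fin p) (h : (ℓ : ℕ) + 1 < p), ∃ s : Fin p, s ≤ ℓ ∧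
      I ⟨(ℓ : ℕ) + 1, h⟩ ∩ (Finset.Iic ℓ).biUnion I ⊆ I s)
    -- variable cliques of the lifted problem
    (A : Fin p → Finset (Fin (n + 1) ⊕ Fin p))
    (hA : ∀ ℓ, A ℓ = insert (Sum.inl 0) (insert (Sum.inr ℓ)
      ((I ℓ).image fun i => Sum.inl i.succ)))
    (ε : ℝ) (hε : 0 < ε) :
    ∃ (σ τ : Fin p → MvPolynomial (Fin (n + 1) ⊕ Fin p) ℝ),
      (∀ ℓ, IsSOSOn (A ℓ) (σ ℓ)) ∧
      (∀ ℓ, (τ ℓ).vars ⊆ A ℓ) ∧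
      rename Sum.inl F
        + C ε * ((∑ i : Fin (n + 1), (X (Sum.inl i)) ^ d) + ∑ ℓ, (X (Sum.inr ℓ)) ^ d)
      = ∑ ℓ, (σ ℓ + τ ℓ * ((X (Sum.inl 0)) ^ 2 + (∑ i ∈ I ℓ, (X (Sum.inl i.succ)) ^ 2)
          + (X (Sum.inr ℓ)) ^ 2 - 1)) := by
  subst hd
  have heven := even_totalDegree_of_nonneg hfnonneg
  set d := f.totalDegree with hd
  have hFpos := eval_nonneg_of_even hFhom heven fun x => (hFdeh x).symm ▸ hfnonneg x
  have hFeq : F = ∑ ℓ, homogenizeTo d (fdec ℓ) := by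
    rw [← homogenizeTo_sum, ← hfdec]
    refine hFhom.eq_of_eval_cons_one (homogenizeTo_isHomogeneous _ _) fun x => ?_
    rw [hFdeh, eval_cons_one_homogenizeTo]
  have h0A : ∀ ℓ, Sum.inl 0 ∈ A ℓ := fun ℓ => by simp [hA]
  have hwA : ∀ ℓ, Sum.inr ℓ ∈ A ℓ := fun ℓ => by simp [hA]
  have hcover : ∀ j, ∃ ℓ, j ∈ A ℓ := by
    rintro (i | ℓ)
    · refine Fin.cases ⟨⟨0, hp⟩, h0A _⟩ (fun i => ?_) i
      obtain ⟨ℓ, hℓ⟩ := hI i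
      exact ⟨ℓ, by simp [hA, hℓ]⟩
    · exact ⟨ℓ, hwA ℓ⟩
  set P : MvPolynomial (Fin (n + 1) ⊕ Fin p) ℝ := rename Sum.inl F
    + C ε * ((∑ i : Fin (n + 1), (X (Sum.inl i)) ^ d) + ∑ ℓ, (X (Sum.inr ℓ)) ^ d) with hPdef
  obtain ⟨G, hGA, hGP⟩ : ∃ G : Fin p → MvPolynomial (Fin (n + 1) ⊕ Fin p) ℝ,
      (∀ ℓ, (G ℓ).vars ⊆ A ℓ) ∧ ∑ ℓ, G ℓ = P := by
    let S : Fin p → Submodule ℝ (MvPolynomial (Fin (n + 1) ⊕ Fin p) ℝ) :=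
      fun ℓ => Subalgebra.toSubmodule (supported ℝ (A ℓ : Set (Fin (n + 1) ⊕ Fin p)))
    have hS : ∀ ℓ q, q ∈ S ℓ ↔ q.vars ⊆ A ℓ := fun ℓ q => by
      simp only [S, Subalgebra.mem_toSubmodule, mem_supported, Finset.coe_subset]
    have hXS : ∀ j, X j ^ d ∈ ⨆ ℓ, S ℓ := by
      intro j
      obtain ⟨ℓ, hℓ⟩ := hcover j
      refine Submodule.mem_iSup_of_mem ℓ ((hS _ _).2 ((vars_pow _ _).trans ?_))
      simpa using hℓ
    have hPS : P ∈ ⨆ ℓ, S ℓ := by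
      rw [hPdef, hFeq, map_sum, C_mul']
      refine add_mem (sum_mem fun ℓ _ => Submodule.mem_iSup_of_mem ℓ ((hS _ _).2 ?_))
        (Submodule.smul_mem _ _ (add_mem (sum_mem fun i _ => hXS _) (sum_mem fun i _ => hXS _)))
      refine (vars_rename _ _).trans ?_
      refine (Finset.image_subset_image (vars_homogenizeTo_subset d _)).trans ?_
      intro j hj
      simp only [Finset.mem_image, Finset.mem_insert] at hj
      obtain ⟨_, rfl | ⟨i, hi, rfl⟩, rfl⟩ := hj
      · exact h0A ℓ
      · simp [hA, hfvars ℓ hi]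
    obtain ⟨μ, hμ, hsum⟩ := (Submodule.mem_iSup_iff_exists_finsupp S P).1 hPS
    refine ⟨μ, fun ℓ => (hS _ _).1 (hμ ℓ), ?_⟩
    rw [← hsum, Finsupp.sum_fintype _ _ fun _ => rfl]
  let g : Fin p → MvPolynomial (Fin (n + 1) ⊕ Fin p) ℝ := fun ℓ => ∑ i ∈ A ℓ, X i ^ 2 - 1
  have hgA : ∀ ℓ, (g ℓ).vars ⊆ A ℓ := by
    intro ℓ
    refine (vars_sub_subset _).trans (Finset.union_subset ((vars_sum_subset _ _).trans
      (Finset.biUnion_subset.2 fun i hi => (vars_pow _ _).trans ?_)) (by simp))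
    simpa using hi
  have hg : ∀ ℓ, g ℓ = (X (Sum.inl 0)) ^ 2 + (∑ i ∈ I ℓ, (X (Sum.inl i.succ)) ^ 2)
      + (X (Sum.inr ℓ)) ^ 2 - 1 := by
    intro ℓ
    simp only [g]
    rw [hA, Finset.sum_insert (by simp [Fin.succ_ne_zero]), Finset.sum_insert (by simp),
      Finset.sum_image (fun i _ j _ hij => Fin.succ_injective _ (Sum.inl_injective hij))]
    ring
  have hPpos : ∀ v, (∀ ℓ, eval v (g ℓ) = 0) → 0 < eval v P := by
    intro v hv
    have hsq : ∑ i ∈ A ⟨0, hp⟩, v i ^ 2 = 1 := by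
      simpa [g, sub_eq_zero] using hv ⟨0, hp⟩
    obtain ⟨j, -, hj⟩ := Finset.exists_ne_zero_of_sum_ne_zero (hsq.trans_ne one_ne_zero)
    have hj0 : 0 < v j ^ d := heven.pow_pos (by simpa using hj)
    have hsum : 0 < ∑ i, v i ^ d :=
      hj0.trans_le (Finset.single_le_sum (f := fun i => v i ^ d)
        (fun i _ => heven.pow_nonneg _) (Finset.mem_univ j))
    rw [Fintype.sum_sum_type] at hsum
    have hF0 := hFpos (v ∘ Sum.inl)
    simp only [hPdef, map_add, map_mul, map_sum, map_pow, eval_C, eval_X, eval_rename]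
    exact add_pos_of_nonneg_of_pos hF0 (mul_pos hε hsum)
  let e : ℕ → Fin p := fun k => if h : k < p then ⟨k, h⟩ else ⟨0, hp⟩
  have he : ∀ ℓ : Fin p, e ℓ = ℓ := fun ℓ => by simp [e]
  have he' : ∀ k (h : k < p), e k = ⟨k, h⟩ := fun k h => dif_pos h
  have hsumG : ∑ k ∈ Finset.range p, G (e k) = P := by
    rw [Finset.sum_range, ← hGP]
    simp only [he]
  obtain ⟨Q, hQA, hQsum, hQpos⟩ := exists_sparse_positive_decomposition (fun k => A (e k))
    (fun k => g (e k)) (fun k => hgA _) p (by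
      intro k hk
      obtain ⟨s, hs, hsI⟩ := hRIP ⟨k, by omega⟩ hk
      refine ⟨s, hs, fun j hj => ?_⟩
      rw [Finset.mem_inter, Finset.mem_biUnion] at hj
      obtain ⟨hj1, l, hl, hj2⟩ := hj
      have hlk : l < k + 1 := Finset.mem_range.1 hl
      rw [he' _ hk, hA] at hj1
      rw [he' l (by omega), hA] at hj2
      rw [he]
      simp only [Finset.mem_insert, Finset.mem_image] at hj1 hj2
      rcases hj1 with rfl | rfl | ⟨i, hi, rfl⟩
      · exact h0A s
      · simp at hj2
        omega
      · simp [Fin.succ_ne_zero] at hj2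
        have hmem : i ∈ I s := hsI (Finset.mem_inter.2 ⟨hi, Finset.mem_biUnion.2
          ⟨⟨l, by omega⟩, Finset.mem_Iic.2 (Nat.lt_succ_iff.1 hlk), hj2⟩⟩)
        simp [hA, hmem]) (fun k => G (e k)) (fun k _ => hGA _) (by
      intro v _ hv _
      rw [hsumG]
      exact hPpos v fun ℓ => he ℓ ▸ hv ℓ ℓ.2)
  have hQ : ∀ ℓ : Fin p, ∃ σ τ, IsSOSOn (A ℓ) σ ∧ τ.vars ⊆ A ℓ ∧ Q ℓ = σ + τ * g ℓ := by
    intro ℓ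
    have h1 := hQA ℓ ℓ.2
    have h2 := hQpos ℓ ℓ.2
    simp only [he] at h1 h2
    exact exists_isSOSOn_add_mul_sphere (A ℓ) h1 h2
  choose σ τ hσ hτ hQστ using hQ
  refine ⟨σ, τ, hσ, hτ, ?_⟩
  rw [← hsumG, ← hQsum, Finset.sum_range]
  exact Finset.sum_congr rfl fun ℓ _ => by rw [hQστ, hg]
end
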